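/- arXiv:2407.06361 — 5 statements merged into one kernel-verified Lean document; each statement's English description precedes it below -/
import Mathlib

section
/- Let T⁺ ⊆ S¹ × S¹ × S¹ denote the subspace of positively oriented triples. For (x,y,z) ∈ T⁺ there is a unique point w = w(x,y,z) ∈ S¹ ∖ {y} such that ξ¹(w) lies on the projective line through ξ¹(y) and ℙ(ξ²(x) ∩ ξ²(z)), and the triple (x, w, z) consists of pairwise distinct points. The map Φ⁻ : T⁺ → flags defined by Φ⁻(x,y,z) = (ℙ(ξ²(w) ∩ ξ²(z)), (ξ²(w) ∩ ξ²(z)) + x¹), where w = w(x,y,z), is well defined with image exactly Ω², and Φ⁻ is a two-sheeted covering map onto Ω². -/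
noncomputable section

open Filter Topology Module
open scoped LinearAlgebra.Projectivization

namespace CFF

instance {K V : Type*} [DivisionRing K] [AddCommGroup V] [Module K V] [TopologicalSpace V] :
    TopologicalSpace (ℙ K V) :=
  inferInstanceAs (TopologicalSpace (Quotient (projectivizationSetoid K V)))

instance : TopologicalSpace (Module.Dual ℝ (Fin 3 → ℝ)) :=
  TopologicalSpace.induced (LinearEquiv.piRing ℝ ℝ (Fin 3) ℝ) inferInstance

/-- The projective line in `ℙ(ℝ³)` determined by a plane `W ≤ ℝ³`. -/
def projLine (W : Submodule ℝ (Fin 3 → ℝ)) : Set (ℙ ℝ (Fin 3 → ℝ)) :=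
  {p | p.submodule ≤ W}

/-- `C ⊆ ℙ(ℝ³)` is properly convex: there is a linear functional `f` nonzero on every nonzero
vector spanning a point of the closure of `C`, such that the image of `C` in the affine chart
`{[v] : f v = 1}` is convex. -/
def ProperlyConvex (C : Set (ℙ ℝ (Fin 3 → ℝ))) : Prop :=
  ∃ f : (Fin 3 → ℝ) →ₗ[ℝ] ℝ,
    (∀ (v : Fin 3 → ℝ) (hv : v ≠ 0), Projectivization.mk ℝ v hv ∈ closure C → f v ≠ 0) ∧
    Convex ℝ {w : Fin 3 → ℝ | f w = 1 ∧ ∃ hw : w ≠ 0, Projectivization.mk ℝ w hw ∈ C}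

/-- The frontier of `C` contains no three distinct collinear points. -/
def StrictlyConvexBoundary (C : Set (ℙ ℝ (Fin 3 → ℝ))) : Prop :=
  ∀ p q r : ℙ ℝ (Fin 3 → ℝ), p ∈ frontier C → q ∈ frontier C → r ∈ frontier C →
    p ≠ q → p ≠ r → q ≠ r →
    ∀ W : Submodule ℝ (Fin 3 → ℝ), finrank ℝ W = 2 →
      ¬ (p.submodule ≤ W ∧ q.submodule ≤ W ∧ r.submodule ≤ W)

/-- `W` determines a supporting line of `C` at the frontier point `p`: a projective line
containing `p` and disjoint from `C`. -/
def IsSupportingLineAt (C : Set (ℙ ℝ (Fin 3 → ℝ))) (W : Submodule ℝ (Fin 3 → ℝ))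
    (p : ℙ ℝ (Fin 3 → ℝ)) : Prop :=
  finrank ℝ W = 2 ∧ p ∈ frontier C ∧ p.submodule ≤ W ∧ projLine W ∩ C = ∅

/-- `(x, y, z)` is a positively oriented triple on the circle: `y` and `z` occur in that order
when traversing the circle counterclockwise starting from `x`.  (This implies the three points
are pairwise distinct.) -/
def PosOriented (x y z : Circle) : Prop :=
  ∃ a b c : ℝ, Circle.exp a = x ∧ Circle.exp b = y ∧ Circle.exp c = z ∧
    a < b ∧ b < c ∧ c < a + 2 * Real.pi

/-- The space of flags `(p, l)`, realized inside `ℙ(ℝ³) × ℙ((ℝ³)*)`: the pair `(p, φ)`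
represents the flag whose line is the plane annihilated by `φ`, and `p` must lie on it. -/
def Flags : Set (ℙ ℝ (Fin 3 → ℝ) × ℙ ℝ (Module.Dual ℝ (Fin 3 → ℝ))) :=
  {pl | pl.1.submodule ≤ pl.2.submodule.dualCoannihilator}

/-- The flags `(p, l)` with `p` outside the closure of `C` and `ℙ(l)` meeting `C`. -/
def Omega2 (C : Set (ℙ ℝ (Fin 3 → ℝ))) :
    Set (ℙ ℝ (Fin 3 → ℝ) × ℙ ℝ (Module.Dual ℝ (Fin 3 → ℝ))) :=
  {pl | pl ∈ Flags ∧ pl.1 ∉ closure C ∧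
    ∃ q ∈ C, q.submodule ≤ pl.2.submodule.dualCoannihilator}


/-- orientation -/
def ori (x y z : Circle) : ℝ :=
  ((y : ℂ).re - (x : ℂ).re) * ((z : ℂ).im - (x : ℂ).im)
    - ((y : ℂ).im - (x : ℂ).im) * ((z : ℂ).re - (x : ℂ).re)

theorem ori_cont : Continuous (fun t : Circle × Circle × Circle => ori t.1 t.2.1 t.2.2) := by
  unfold ori
  have h1 : Continuous (fun t : Circle => (t : ℂ).re) := Complex.continuous_re.comp (by fun_prop)
  have h2 : Continuous (fun t : Circle => (t : ℂ).im) := Complex.continuous_im.comp (by fun_prop)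
  fun_prop

theorem ori_cyc (x y z : Circle) : ori x y z = ori y z x := by unfold ori; ring
theorem ori_swap (x y z : Circle) : ori x y z = - ori x z y := by unfold ori; ring

/-- half-angle sine -/
def sh (a b : ℝ) : ℝ := Real.sin ((b - a) / 2)

theorem sh_anti (a b : ℝ) : sh a b = - sh b a := by
  unfold sh; rw [← Real.sin_neg]; congr 1; ring

theorem ori_exp (a b c : ℝ) :
    ori (Circle.exp a) (Circle.exp b) (Circle.exp c) = 4 * sh a b * sh b c * sh a c := by
  have e : ∀ t : ℝ, ((Circle.exp t : Circle) : ℂ).re = Real.cos t ∧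
      ((Circle.exp t : Circle) : ℂ).im = Real.sin t := by
    intro t
    rw [Circle.coe_exp]
    exact ⟨Complex.exp_ofReal_mul_I_re t, Complex.exp_ofReal_mul_I_im t⟩
  unfold ori sh
  rw [(e a).1, (e a).2, (e b).1, (e b).2, (e c).1, (e c).2]
  have h1 : (Real.cos b - Real.cos a) * (Real.sin c - Real.sin a) -
      (Real.sin b - Real.sin a) * (Real.cos c - Real.cos a)
      = Real.sin (b - a) + Real.sin (c - b) - Real.sin (c - a) := by
    rw [Real.sin_sub, Real.sin_sub, Real.sin_sub]; ring
  rw [h1]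
  set X := (b - a) / 2 with hX
  set Y := (c - b) / 2 with hY
  have e1 : b - a = 2 * X := by rw [hX]; ring
  have e2 : c - b = 2 * Y := by rw [hY]; ring
  have e3 : c - a = 2 * X + 2 * Y := by rw [hX, hY]; ring
  have e4 : (c - a) / 2 = X + Y := by rw [hX, hY]; ring
  rw [e4, e1, e2, e3, Real.sin_add, Real.sin_add, Real.sin_two_mul, Real.sin_two_mul,
    Real.cos_two_mul, Real.cos_two_mul]
  have p1 := Real.sin_sq_add_cos_sq X
  have p2 := Real.sin_sq_add_cos_sq Y
  linear_combination (-4 * Real.sin X * Real.cos X) * p2 - 4 * Real.sin Y * Real.cos Y * p1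

theorem exp_eq_of_sh (a b : ℝ) (h : sh a b = 0) : Circle.exp a = Circle.exp b := by
  obtain ⟨n, hn⟩ := Real.sin_eq_zero_iff.mp h
  rw [Circle.exp_eq_exp]
  exact ⟨-n, by push_cast; linarith⟩

theorem sh_of_exp_eq (a b : ℝ) (h : Circle.exp a = Circle.exp b) : sh a b = 0 := by
  rw [Circle.exp_eq_exp] at h
  obtain ⟨m, hm⟩ := h
  unfold sh
  rw [Real.sin_eq_zero_iff]
  exact ⟨-m, by rw [hm]; push_cast; ring⟩

theorem exp_surj (x : Circle) : ∃ a : ℝ, Circle.exp a = x := ⟨Complex.arg x, Circle.exp_arg x⟩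

theorem ori_ne (x y z : Circle) (h1 : x ≠ y) (h2 : y ≠ z) (h3 : x ≠ z) : ori x y z ≠ 0 := by
  obtain ⟨a, rfl⟩ := exp_surj x
  obtain ⟨b, rfl⟩ := exp_surj y
  obtain ⟨c, rfl⟩ := exp_surj z
  rw [ori_exp]
  have := fun h => h1 (exp_eq_of_sh _ _ h)
  have := fun h => h2 (exp_eq_of_sh _ _ h)
  have := fun h => h3 (exp_eq_of_sh _ _ h)
  positivity

theorem ori_ne' {x y z : Circle} (h : ori x y z ≠ 0) : x ≠ y ∧ y ≠ z ∧ x ≠ z := by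
  refine ⟨?_, ?_, ?_⟩ <;> rintro rfl <;> apply h <;> unfold ori <;> ring

/-- separation is symmetric -/
theorem ori_sep (a b w z : Circle) (hab : a ≠ b) (h : ori a w b * ori a z b < 0) :
    ori a w z * ori b w z < 0 := by
  have hwz : w ≠ z := by
    rintro rfl
    nlinarith [mul_self_nonneg (ori a w b)]
  obtain ⟨a, rfl⟩ := exp_surj a
  obtain ⟨b, rfl⟩ := exp_surj b
  obtain ⟨w, rfl⟩ := exp_surj w
  obtain ⟨z, rfl⟩ := exp_surj z
  have h1 : sh a b ≠ 0 := fun h => hab (exp_eq_of_sh _ _ h)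
  have h2 : sh w z ≠ 0 := fun h => hwz (exp_eq_of_sh _ _ h)
  simp only [ori_exp] at h ⊢
  rw [sh_anti b w, sh_anti b z]
  rw [sh_anti z b, sh_anti w b] at h ⊢
  have h1' : 0 < (sh a b) ^ 2 := by positivity
  have h2' : 0 < (sh w z) ^ 2 := by positivity
  have h3 : sh a w * sh b w * (sh a z * sh b z) < 0 := by
    by_contra hc
    push Not at hc
    have := mul_nonneg hc h1'.le
    nlinarith
  have := mul_neg_of_neg_of_pos h3 h2'
  nlinarith

theorem sh_pos {a b : ℝ} (h : a < b) (h' : b < a + 2 * Real.pi) : 0 < sh a b :=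
  Real.sin_pos_of_pos_of_lt_pi (by linarith) (by linarith)

theorem lift_Ico (a : ℝ) (x : Circle) : ∃ b, a ≤ b ∧ b < a + 2 * Real.pi ∧ Circle.exp b = x := by
  obtain ⟨b, rfl⟩ := exp_surj x
  have hp := Real.two_pi_pos
  refine ⟨toIcoMod hp a b, left_le_toIcoMod hp a b, toIcoMod_lt_right hp a b, ?_⟩
  rw [Circle.exp_eq_exp]
  refine ⟨- toIcoDiv hp a b, ?_⟩
  have := toIcoMod_add_toIcoDiv_zsmul hp a b
  rw [zsmul_eq_mul] at this
  push_cast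
  linarith

theorem pos_iff (x y z : Circle) : PosOriented x y z ↔ 0 < ori x y z := by
  constructor
  · rintro ⟨a, b, c, rfl, rfl, rfl, h1, h2, h3⟩
    rw [ori_exp]
    have := sh_pos h1 (by linarith)
    have := sh_pos h2 (by linarith)
    have := sh_pos (h1.trans h2) (by linarith)
    positivity
  · intro h
    obtain ⟨h1, h2, h3⟩ := ori_ne' h.ne'
    obtain ⟨a, rfl⟩ := exp_surj x
    obtain ⟨b, hb1, hb2, rfl⟩ := lift_Ico a y
    obtain ⟨c, hc1, hc2, rfl⟩ := lift_Ico a z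
    have hb : a < b := lt_of_le_of_ne hb1 (by rintro rfl; exact h1 rfl)
    have hc : a < c := lt_of_le_of_ne hc1 (by rintro rfl; exact h3 rfl)
    refine ⟨a, b, c, rfl, rfl, rfl, hb, ?_, hc2⟩
    by_contra hcb
    have hlt : c < b := lt_of_le_of_ne (not_lt.mp hcb) (by rintro rfl; exact h2 rfl)
    rw [ori_exp, sh_anti b c] at h
    have := sh_pos hb hb2
    have := sh_pos hc hc2
    have := sh_pos hlt (by linarith)
    have : 0 < 4 * sh a b * sh c b * sh a c := by positivity
    linarith

/-- intermediate values on both arcs -/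
theorem circle_ivt (h : Circle → ℝ) (hc : Continuous h) (a b : Circle) (ha : h a < 0) (hb : 0 < h b) :
    ∃ u v, h u = 0 ∧ h v = 0 ∧ 0 < ori a u b ∧ ori a v b < 0 := by
  have hab : a ≠ b := by rintro rfl; linarith
  obtain ⟨a, rfl⟩ := exp_surj a
  obtain ⟨b, hb1, hb2, rfl⟩ := lift_Ico a b
  have hlt : a < b := lt_of_le_of_ne hb1 (by rintro rfl; exact hab rfl)
  have hcc : Continuous (fun t => h (Circle.exp t)) := hc.comp Circle.exp.continuous
  obtain ⟨u, hu, hu0⟩ := intermediate_value_Icc hb1 hcc.continuousOn ⟨ha.le, hb.le⟩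
  have h2 : h (Circle.exp (a + 2 * Real.pi)) < 0 := by
    rwa [Circle.exp_add, Circle.exp_two_pi, mul_one]
  obtain ⟨v, hv, hv0⟩ := intermediate_value_Icc' hb2.le hcc.continuousOn ⟨h2.le, hb.le⟩
  simp only at hu0 hv0
  have u1 : a < u := lt_of_le_of_ne hu.1 (by rintro rfl; linarith)
  have u2 : u < b := lt_of_le_of_ne hu.2 (by rintro rfl; linarith)
  have v1 : b < v := lt_of_le_of_ne hv.1 (by rintro rfl; linarith)
  have v2 : v < a + 2 * Real.pi := lt_of_le_of_ne hv.2 (by rintro rfl; linarith)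
  refine ⟨Circle.exp u, Circle.exp v, hu0, hv0, ?_, ?_⟩
  · rw [ori_exp]
    have := sh_pos u1 (by linarith)
    have := sh_pos u2 (by linarith)
    have := sh_pos hlt (by linarith)
    positivity
  · rw [ori_exp, sh_anti v b]
    have := sh_pos (hlt.trans v1) v2
    have := sh_pos v1 (by linarith)
    have := sh_pos hlt (by linarith)
    have : 0 < 4 * sh a v * sh b v * sh a b := by positivity
    linarith

theorem cover2 {X Y : Type*} [TopologicalSpace X] [TopologicalSpace Y] (Φ : X → Y)
    (hp : IsProperMap Φ)
    (hU : ∀ b, ∃ U1 U2 : Set X, IsOpen U1 ∧ IsOpen U2 ∧ Disjoint U1 U2 ∧ Set.InjOn Φ U1 ∧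
      Set.InjOn Φ U2 ∧ Φ ⁻¹' {b} ⊆ U1 ∪ U2)
    (hcard : ∀ b, (Φ ⁻¹' {b}).ncard = 2) : IsCoveringMap Φ := by
  classical
  intro b
  obtain ⟨U1, U2, o1, o2, hd, i1, i2, hb⟩ := hU b
  apply IsEvenlyCovered.to_isEvenlyCovered_preimage (I := Bool)
  refine ⟨inferInstance, (Φ '' (U1 ∪ U2)ᶜ)ᶜ, ?_, ?_, ?_⟩
  · rintro ⟨x, hx, hxb⟩
    exact hx (hb hxb)
  · exact (hp.isClosedMap _ (o1.union o2).isClosed_compl).isOpen_compl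
  set V : Set Y := (Φ '' (U1 ∪ U2)ᶜ)ᶜ with hV
  have hVo : IsOpen V := (hp.isClosedMap _ (o1.union o2).isClosed_compl).isOpen_compl
  refine ⟨hVo.preimage hp.continuous, ?_⟩
  have hmem : ∀ x, Φ x ∈ V → x ∈ U1 ∪ U2 := by
    intro x hx
    by_contra h
    exact hx ⟨x, h, rfl⟩
  let H : Φ ⁻¹' V → V × Bool := fun e => (⟨Φ e, e.2⟩, decide (e.1 ∈ U1))
  have hcl : IsClopen {e : Φ ⁻¹' V | e.1 ∈ U1} := by
    refine ⟨?_, o1.preimage continuous_subtype_val⟩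
    have : {e : Φ ⁻¹' V | e.1 ∈ U1} = {e : Φ ⁻¹' V | e.1 ∈ U2}ᶜ := by
      ext e
      simp only [Set.mem_setOf_eq, Set.mem_compl_iff]
      constructor
      · intro h h'
        exact Set.disjoint_left.mp hd h h'
      · intro h
        exact (hmem e.1 e.2).resolve_right h
    rw [this]
    exact (o2.preimage continuous_subtype_val).isClosed_compl
  have hHc : Continuous H := by
    refine Continuous.prodMk ?_ ?_
    · exact (hp.continuous.comp continuous_subtype_val).subtype_mk _
    · rw [continuous_bool_rng true]
      convert hcl using 1
      ext e
      simp
  have hinj : Function.Injective H := by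
    rintro ⟨e, he⟩ ⟨e', he'⟩ h
    simp only [H, Prod.mk.injEq, Subtype.mk.injEq, decide_eq_decide] at h
    apply Subtype.ext
    by_cases h1 : e ∈ U1
    · exact i1 h1 (h.2.mp h1) h.1
    · exact i2 ((hmem e he).resolve_left h1) ((hmem e' he').resolve_left (fun h2 => h1 (h.2.mpr h2))) h.1
  have hsurj : Function.Surjective H := by
    rintro ⟨⟨y, hy⟩, i⟩
    obtain ⟨s, t, hst, hf⟩ := Set.ncard_eq_two.mp (hcard y)
    have hs : Φ s = y := by
      have : s ∈ Φ ⁻¹' {y} := by rw [hf]; simp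
      exact this
    have ht : Φ t = y := by
      have : t ∈ Φ ⁻¹' {y} := by rw [hf]; simp
      exact this
    have hsV : Φ s ∈ V := by rw [hs]; exact hy
    have htV : Φ t ∈ V := by rw [ht]; exact hy
    have key : ∀ j : Bool, ∃ e, Φ e = y ∧ decide (e ∈ U1) = j := by
      by_cases h1 : s ∈ U1
      · have h2 : t ∉ U1 := fun h => hst (i1 h1 h (hs.trans ht.symm))
        intro j
        cases j
        · exact ⟨t, ht, by simp [h2]⟩
        · exact ⟨s, hs, by simp [h1]⟩
      · have h2 : t ∈ U1 := by
          by_contra h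
          exact hst (i2 ((hmem s hsV).resolve_left h1) ((hmem t htV).resolve_left h) (hs.trans ht.symm))
        intro j
        cases j
        · exact ⟨s, hs, by simp [h1]⟩
        · exact ⟨t, ht, by simp [h2]⟩
    obtain ⟨e, he, hj⟩ := key i
    exact ⟨⟨e, by rw [Set.mem_preimage, he]; exact hy⟩, Prod.ext (Subtype.ext he) hj⟩
  have hHp : IsProperMap H := by
    rw [isProperMap_iff_ultrafilter]
    refine ⟨hHc, ?_⟩
    rintro 𝒰 ⟨y, i⟩ h
    have hr : IsProperMap (V.restrictPreimage Φ) := hp.restrictPreimage V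
    have h1 : Tendsto (V.restrictPreimage Φ) 𝒰 (𝓝 y) := (continuous_fst.tendsto (y, i)).comp h
    obtain ⟨x, hx, hle⟩ := hr.ultrafilter_le_nhds_of_tendsto h1
    refine ⟨x, ?_, hle⟩
    refine Prod.ext hx ?_
    have h2 : Tendsto (fun e => (H e).2) 𝒰 (𝓝 i) := (continuous_snd.tendsto (y, i)).comp h
    have h3 : Tendsto (fun e => (H e).2) 𝒰 (𝓝 (H x).2) :=
      ((continuous_snd.comp hHc).tendsto x).mono_left hle
    exact tendsto_nhds_unique h3 h2
  have hh : IsHomeomorph H :=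
    isHomeomorph_iff_continuous_isClosedMap_bijective.mpr ⟨hHc, hHp.isClosedMap, hinj, hsurj⟩
  exact ⟨hh.homeomorph, fun x => rfl⟩

abbrev E3 := Fin 3 → ℝ

def dt (u v : E3) : ℝ := u 0 * v 0 + u 1 * v 1 + u 2 * v 2

def cr (u v : E3) : E3 := ![u 1 * v 2 - u 2 * v 1, u 2 * v 0 - u 0 * v 2, u 0 * v 1 - u 1 * v 0]

theorem dt_cont : Continuous (fun t : E3 × E3 => dt t.1 t.2) := by unfold dt; fun_prop

theorem dt_tendsto {α : Type*} {l : Filter α} {f g : α → E3} {a b : E3} (hf : Tendsto f l (𝓝 a))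
    (hg : Tendsto g l (𝓝 b)) : Tendsto (fun i => dt (f i) (g i)) l (𝓝 (dt a b)) :=
  (dt_cont.tendsto (a, b)).comp (hf.prodMk_nhds hg)

theorem cr_cont : Continuous (fun t : E3 × E3 => cr t.1 t.2) := by
  unfold cr
  refine continuous_pi fun i => ?_
  fin_cases i <;> simp <;> fun_prop

theorem dt_comm (u v : E3) : dt u v = dt v u := by unfold dt; ring
theorem dt_add (u v w : E3) : dt u (v + w) = dt u v + dt u w := by simp [dt]; ring
theorem dt_sub (u v w : E3) : dt u (v - w) = dt u v - dt u w := by simp [dt]; ring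
theorem dt_smul (u v : E3) (c : ℝ) : dt u (c • v) = c * dt u v := by simp [dt]; ring
theorem add_dt (u v w : E3) : dt (v + w) u = dt v u + dt w u := by simp [dt]; ring
theorem sub_dt (u v w : E3) : dt (v - w) u = dt v u - dt w u := by simp [dt]; ring
theorem smul_dt (u v : E3) (c : ℝ) : dt (c • v) u = c * dt v u := by simp [dt]; ring
theorem dt_zero (u : E3) : dt u 0 = 0 := by simp [dt]
theorem zero_dt (u : E3) : dt 0 u = 0 := by simp [dt]
theorem dt_self_pos {u : E3} (h : u ≠ 0) : 0 < dt u u := by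
  by_contra hc
  apply h
  unfold dt at hc
  have h0 : u 0 = 0 := by nlinarith [mul_self_nonneg (u 0), mul_self_nonneg (u 1), mul_self_nonneg (u 2)]
  have h1 : u 1 = 0 := by nlinarith [mul_self_nonneg (u 0), mul_self_nonneg (u 1), mul_self_nonneg (u 2)]
  have h2 : u 2 = 0 := by nlinarith [mul_self_nonneg (u 0), mul_self_nonneg (u 1), mul_self_nonneg (u 2)]
  ext i
  fin_cases i <;> simp [h0, h1, h2]

theorem dt_cr_left (u v : E3) : dt u (cr u v) = 0 := by simp [dt, cr]; ring
theorem dt_cr_right (u v : E3) : dt v (cr u v) = 0 := by simp [dt, cr]; ring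
theorem cr_cr (u v w : E3) : cr (cr u v) w = dt u w • v - dt v w • u := by
  ext i
  fin_cases i <;> simp [dt, cr] <;> ring

theorem cr_cr' (u v : E3) : dt u u • v = dt u v • u - cr u (cr u v) := by
  ext i
  fin_cases i <;> simp [dt, cr] <;> ring

/-- the common kernel of two independent functionals is spanned by the cross product -/
theorem mem_span_cr {u v w : E3} (h : cr u v ≠ 0) (h1 : dt u w = 0) (h2 : dt v w = 0) :
    w ∈ Submodule.span ℝ {cr u v} := by
  rw [Submodule.mem_span_singleton]
  have h3 : cr (cr u v) w = 0 := by rw [cr_cr, h1, h2]; simp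
  have h4 := cr_cr' (cr u v) w
  have hz : cr (cr u v) 0 = 0 := by
    ext i
    fin_cases i <;> simp [cr]
  rw [h3, hz, sub_zero] at h4
  have hp := dt_self_pos h
  refine ⟨dt (cr u v) w / dt (cr u v) (cr u v), ?_⟩
  rw [div_eq_inv_mul, mul_smul, ← h4, smul_smul, inv_mul_cancel₀ hp.ne', one_smul]

def fnl (n : E3) : Module.Dual ℝ E3 where
  toFun v := dt n v
  map_add' := dt_add n
  map_smul' c v := dt_smul n v c

def vec (F : Module.Dual ℝ E3) : E3 := fun i => F (Pi.single i 1)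

theorem vec_apply (F : Module.Dual ℝ E3) (v : E3) : F v = dt (vec F) v := by
  conv_lhs => rw [show v = v 0 • Pi.single 0 1 + v 1 • Pi.single 1 1 + v 2 • Pi.single 2 1 by
    ext i
    fin_cases i <;> simp]
  simp only [map_add, map_smul, dt, vec, smul_eq_mul]
  ring

theorem fnl_apply (n v : E3) : fnl n v = dt n v := rfl

theorem fnl_vec (F : Module.Dual ℝ E3) : fnl (vec F) = F := by
  ext1 v
  ext
  simp [fnl_apply, ← vec_apply]

theorem vec_fnl (n : E3) : vec (fnl n) = n := by
  ext i
  simp only [vec, fnl_apply, dt]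
  fin_cases i <;> simp

theorem vec_ne {F : Module.Dual ℝ E3} (h : F ≠ 0) : vec F ≠ 0 := by
  intro h'
  apply h
  rw [← fnl_vec F, h']
  ext1 v
  ext
  simp [fnl_apply, zero_dt]

theorem fnl_ne {n : E3} (h : n ≠ 0) : fnl n ≠ 0 := by
  intro h'
  apply h
  rw [← vec_fnl n, h']
  ext i
  simp [vec]

theorem vec_eq : (vec : Module.Dual ℝ E3 → E3) = LinearEquiv.piRing ℝ ℝ (Fin 3) ℝ := by
  funext F
  ext i
  simp [vec]

theorem vec_cont : Continuous vec := by
  rw [vec_eq]; exact continuous_induced_dom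

theorem fnl_cont : Continuous fnl := by
  refine continuous_induced_rng.mpr ?_
  rw [← vec_eq]
  have : vec ∘ fnl = id := funext vec_fnl
  rw [this]
  exact continuous_id

instance dualCS : ContinuousSMul ℝ (Module.Dual ℝ E3) :=
  continuousSMul_induced (LinearEquiv.piRing ℝ ℝ (Fin 3) ℝ)

section proj0
variable {V : Type*} [AddCommGroup V] [Module ℝ V]

def sec (g : V →ₗ[ℝ] ℝ) (p : ℙ ℝ V) : V := (g p.rep)⁻¹ • p.rep

theorem sec_mk (g : V →ₗ[ℝ] ℝ) (v : V) (hv : v ≠ 0) :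
    sec g (Projectivization.mk ℝ v hv) = (g v)⁻¹ • v := by
  obtain ⟨a, ha⟩ := Projectivization.exists_smul_eq_mk_rep ℝ v hv
  unfold sec
  rw [← ha, Units.smul_def, map_smul, smul_smul, smul_eq_mul, mul_inv]
  congr 1
  field_simp

theorem sec_mem (g : V →ₗ[ℝ] ℝ) (p : ℙ ℝ V) : sec g p ∈ p.submodule := by
  rw [Projectivization.submodule_eq]
  exact Submodule.smul_mem _ _ (Submodule.mem_span_singleton_self _)

end proj0

section proj
variable {V : Type*} [AddCommGroup V] [Module ℝ V] [TopologicalSpace V]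

theorem mk_cont : Continuous (Projectivization.mk' ℝ : {v : V // v ≠ 0} → ℙ ℝ V) :=
  continuous_quot_mk

theorem mk_tendsto {α : Type*} {l : Filter α} {u : α → V} (hu : ∀ i, u i ≠ 0) {v : V} (hv : v ≠ 0)
    (h : Tendsto u l (𝓝 v)) : Tendsto (fun i => Projectivization.mk ℝ (u i) (hu i)) l
      (𝓝 (Projectivization.mk ℝ v hv)) := by
  have h1 : Tendsto (fun i => (⟨u i, hu i⟩ : {v : V // v ≠ 0})) l (𝓝 ⟨v, hv⟩) :=
    tendsto_subtype_rng.mpr h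
  exact (mk_cont.tendsto _).comp h1

theorem mk_open [ContinuousSMul ℝ V] :
    IsOpenMap (Projectivization.mk' ℝ : {v : V // v ≠ 0} → ℙ ℝ V) := by
  intro U hU
  have hq : IsQuotientMap (Projectivization.mk' ℝ : {v : V // v ≠ 0} → ℙ ℝ V) := isQuotientMap_quot_mk
  rw [← hq.isOpen_preimage]
  have : Projectivization.mk' ℝ ⁻¹' (Projectivization.mk' ℝ '' U) =
      ⋃ c : ℝˣ, (fun v : {v : V // v ≠ 0} => (⟨c • v.1, by
        simpa [Units.smul_def] using v.2⟩ : {v : V // v ≠ 0})) ⁻¹' U := by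
    ext v
    simp only [Set.mem_preimage, Set.mem_image, Set.mem_iUnion]
    constructor
    · rintro ⟨w, hw, h⟩
      rw [Projectivization.mk'_eq_mk, Projectivization.mk'_eq_mk, Projectivization.mk_eq_mk_iff] at h
      obtain ⟨a, ha⟩ := h
      refine ⟨a, ?_⟩
      convert hw
    · rintro ⟨c, hc⟩
      refine ⟨_, hc, ?_⟩
      rw [Projectivization.mk'_eq_mk, Projectivization.mk'_eq_mk, Projectivization.mk_eq_mk_iff]
      exact ⟨c, rfl⟩
  rw [this]
  refine isOpen_iUnion fun c => hU.preimage ?_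
  refine Continuous.subtype_mk ?_ _
  exact (continuous_const_smul (c : ℝ)).comp continuous_subtype_val

theorem nhds_mk [ContinuousSMul ℝ V] (v : V) (hv : v ≠ 0) :
    𝓝 (Projectivization.mk ℝ v hv) = map (Projectivization.mk' ℝ) (𝓝 (⟨v, hv⟩ : {v : V // v ≠ 0})) :=
  (mk_open.map_nhds_eq mk_cont.continuousAt).symm

theorem sec_tendsto [ContinuousSMul ℝ V] (g : V →ₗ[ℝ] ℝ) (hg : Continuous g) (v : V) (hv : v ≠ 0)
    (h : g v ≠ 0) : Tendsto (sec g) (𝓝 (Projectivization.mk ℝ v hv)) (𝓝 ((g v)⁻¹ • v)) := by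
  rw [nhds_mk, tendsto_map'_iff]
  have : (sec g ∘ Projectivization.mk' ℝ : {v : V // v ≠ 0} → V) = fun w => (g w.1)⁻¹ • w.1 := by
    funext w
    exact sec_mk g w.1 w.2
  rw [this]
  have h1 : ContinuousAt (fun w : V => (g w)⁻¹ • w) v :=
    ContinuousAt.smul (hg.continuousAt.inv₀ h) continuousAt_id
  exact h1.tendsto.comp continuous_subtype_val.continuousAt

end proj

/-- lifting convergence -/
theorem lift_tendsto {α : Type*} {l : Filter α} {p : α → ℙ ℝ E3} {p0 : ℙ ℝ E3}
    (h : Tendsto p l (𝓝 p0)) :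
    ∃ s : α → E3, (∀ i, s i ∈ (p i).submodule) ∧ Tendsto s l (𝓝 p0.rep) := by
  have hp := dt_self_pos p0.rep_nonzero
  let g : E3 →ₗ[ℝ] ℝ := (dt p0.rep p0.rep)⁻¹ • fnl p0.rep
  have hg1 : g p0.rep = 1 := by
    simp only [g, LinearMap.smul_apply, fnl_apply, smul_eq_mul]; field_simp
  have hg : Continuous g := by
    have : (g : E3 → ℝ) = fun v => (dt p0.rep p0.rep)⁻¹ * dt p0.rep v := by
      funext v; simp [g, fnl_apply]
    rw [this]
    unfold dt
    fun_prop
  refine ⟨fun i => sec g (p i), fun i => sec_mem g _, ?_⟩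
  have := sec_tendsto g hg p0.rep p0.rep_nonzero (by rw [hg1]; exact one_ne_zero)
  rw [hg1, inv_one, one_smul, Projectivization.mk_rep] at this
  exact this.comp h

theorem lift_tendsto_dual {α : Type*} {l : Filter α} {p : α → ℙ ℝ (Module.Dual ℝ E3)}
    {p0 : ℙ ℝ (Module.Dual ℝ E3)} (h : Tendsto p l (𝓝 p0)) :
    ∃ s : α → E3, (∀ i, fnl (s i) ∈ (p i).submodule) ∧ Tendsto s l (𝓝 (vec p0.rep)) := by
  have hp := dt_self_pos (vec_ne p0.rep_nonzero)
  set n := vec p0.rep with hn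
  let g : Module.Dual ℝ E3 →ₗ[ℝ] ℝ := (dt n n)⁻¹ • (LinearMap.applyₗ n)
  have hg0 : ∀ F, g F = (dt n n)⁻¹ * dt (vec F) n := by
    intro F
    simp [g, vec_apply F]
  have hg1 : g p0.rep = 1 := by
    rw [hg0]; field_simp; rfl
  have hg : Continuous g := by
    have : (g : Module.Dual ℝ E3 → ℝ) = fun F => (dt n n)⁻¹ * dt (vec F) n := by
      funext F; exact hg0 F
    rw [this]
    have h2 : Continuous fun F => dt (vec F) n :=
      dt_cont.comp (vec_cont.prodMk (continuous_const (y := n)))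
    exact continuous_const.mul h2
  refine ⟨fun i => vec (sec g (p i)), fun i => ?_, ?_⟩
  · rw [fnl_vec]; exact sec_mem g _
  have := sec_tendsto g hg p0.rep p0.rep_nonzero (by rw [hg1]; exact one_ne_zero)
  rw [hg1, inv_one, one_smul, Projectivization.mk_rep] at this
  exact (vec_cont.tendsto _).comp (this.comp h)

structure Geo (γ φ : Circle → E3) : Prop where
  cγ : Continuous γ
  cφ : Continuous φ
  z : ∀ x, dt (φ x) (γ x) = 0
  pos : ∀ x y, x ≠ y → 0 < dt (φ x) (γ y)
  col : ∀ n : E3, n ≠ 0 → ∀ x y z, x ≠ y → x ≠ z → y ≠ z →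
    dt n (γ x) = 0 → dt n (γ y) = 0 → dt n (γ z) = 0 → False

section geo
variable {γ φ : Circle → E3}

theorem Geo.cont (G : Geo γ φ) : Continuous (fun t : Circle × Circle => dt (φ t.1) (γ t.2)) :=
  dt_cont.comp ((G.cφ.comp continuous_fst).prodMk (G.cγ.comp continuous_snd))

theorem Geo.tendsto (G : Geo γ φ) {α : Type*} {l : Filter α} {f g : α → Circle} {a b : Circle}
    (hf : Tendsto f l (𝓝 a)) (hg : Tendsto g l (𝓝 b)) :
    Tendsto (fun i => dt (φ (f i)) (γ (g i))) l (𝓝 (dt (φ a) (γ b))) :=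
  (G.cont.tendsto (a, b)).comp (hf.prodMk_nhds hg)

theorem ori_tendsto {α : Type*} {l : Filter α} {f g h : α → Circle} {a b c : Circle}
    (hf : Tendsto f l (𝓝 a)) (hg : Tendsto g l (𝓝 b)) (hh : Tendsto h l (𝓝 c)) :
    Tendsto (fun i => ori (f i) (g i) (h i)) l (𝓝 (ori a b c)) :=
  (ori_cont.tendsto (a, b, c)).comp (hf.prodMk_nhds (hg.prodMk_nhds hh))

theorem Geo.pencil_ne (G : Geo γ φ) {x y z : Circle} (hyz : y ≠ z) (hxz : x ≠ z) :
    dt (φ z) (γ y) • φ x - dt (φ x) (γ y) • φ z ≠ 0 := by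
  intro h
  have h1 : dt (dt (φ z) (γ y) • φ x - dt (φ x) (γ y) • φ z) (γ z) = 0 := by rw [h, zero_dt]
  rw [sub_dt, smul_dt, smul_dt, G.z, mul_zero, sub_zero] at h1
  have := mul_pos (G.pos z y hyz.symm) (G.pos x z hxz)
  linarith

theorem Geo.w_unique (G : Geo γ φ) {x y z w w' : Circle} (hyz : y ≠ z) (hxz : x ≠ z)
    (hw : w ≠ y) (hw' : w' ≠ y)
    (h : dt (φ x) (γ w) * dt (φ z) (γ y) = dt (φ z) (γ w) * dt (φ x) (γ y))
    (h' : dt (φ x) (γ w') * dt (φ z) (γ y) = dt (φ z) (γ w') * dt (φ x) (γ y)) : w = w' := by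
  by_contra hne
  refine G.col _ (G.pencil_ne hyz hxz) y w w' hw.symm hw'.symm hne ?_ ?_ ?_
  · rw [sub_dt, smul_dt, smul_dt]; ring
  · rw [sub_dt, smul_dt, smul_dt]; linarith
  · rw [sub_dt, smul_dt, smul_dt]; linarith

/-- the relation between the four points excludes the end points -/
theorem Geo.w_ne (G : Geo γ φ) {x y z w : Circle} (hxy : x ≠ y) (hyz : y ≠ z) (hxz : x ≠ z)
    (h : dt (φ x) (γ w) * dt (φ z) (γ y) = dt (φ z) (γ w) * dt (φ x) (γ y)) : w ≠ x ∧ w ≠ z := by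
  constructor
  · rintro rfl
    rw [G.z, zero_mul] at h
    have := mul_pos (G.pos z w hxz.symm) (G.pos w y hxy)
    linarith
  · rintro rfl
    rw [G.z, zero_mul] at h
    have := mul_pos (G.pos x w hxz) (G.pos w y hyz.symm)
    linarith

theorem Geo.exists_w (G : Geo γ φ) {x y z : Circle} (hxy : x ≠ y) (hyz : y ≠ z) (hxz : x ≠ z) :
    ∃ w, w ≠ y ∧ dt (φ x) (γ w) * dt (φ z) (γ y) = dt (φ z) (γ w) * dt (φ x) (γ y) ∧
      ori x w z * ori x y z < 0 := by
  have hc : Continuous (fun w => dt (φ x) (γ w) * dt (φ z) (γ y) - dt (φ z) (γ w) * dt (φ x) (γ y)) := by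
    have h1 : Continuous (fun w => dt (φ x) (γ w)) := dt_cont.comp (continuous_const.prodMk G.cγ)
    have h2 : Continuous (fun w => dt (φ z) (γ w)) := dt_cont.comp (continuous_const.prodMk G.cγ)
    exact (h1.mul continuous_const).sub (h2.mul continuous_const)
  obtain ⟨u, v, hu, hv, hu1, hv1⟩ := circle_ivt _ hc x z (by
    have := mul_pos (G.pos z x hxz.symm) (G.pos x y hxy)
    simp only [G.z]; linarith) (by
    have := mul_pos (G.pos x z hxz) (G.pos z y hyz.symm)
    simp only [G.z]; linarith)
  have hne := ori_ne x y z hxy hyz hxz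
  rcases lt_or_gt_of_ne hne with h | h
  · refine ⟨u, ?_, by linarith, by nlinarith⟩
    rintro rfl; linarith
  · refine ⟨v, ?_, by linarith, by nlinarith⟩
    rintro rfl; linarith

theorem Geo.concur (G : Geo γ φ) {u v w : Circle} (huv : u ≠ v) (huw : u ≠ w) (hvw : v ≠ w)
    {p : E3} (hp : p ≠ 0) (h1 : dt (φ u) p = 0) (h2 : dt (φ v) p = 0) (h3 : dt (φ w) p = 0) :
    False := by
  have key : dt (φ u) (cr (φ v) (φ w)) * dt (γ u) (cr (γ v) (γ w)) =
      dt (φ u) (γ v) * dt (φ v) (γ w) * dt (φ w) (γ u) +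
      dt (φ u) (γ w) * dt (φ v) (γ u) * dt (φ w) (γ v) := by
    have := G.z u
    have e1 := G.z u
    have e2 := G.z v
    have e3 := G.z w
    have gram : dt (φ u) (cr (φ v) (φ w)) * dt (γ u) (cr (γ v) (γ w)) =
      dt (φ u) (γ u) * (dt (φ v) (γ v) * dt (φ w) (γ w) - dt (φ v) (γ w) * dt (φ w) (γ v))
      - dt (φ u) (γ v) * (dt (φ v) (γ u) * dt (φ w) (γ w) - dt (φ v) (γ w) * dt (φ w) (γ u))
      + dt (φ u) (γ w) * (dt (φ v) (γ u) * dt (φ w) (γ v) - dt (φ v) (γ v) * dt (φ w) (γ u)) := by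
      simp [dt, cr]; ring
    rw [gram, e1, e2, e3]; ring
  have hpos : 0 < dt (φ u) (cr (φ v) (φ w)) * dt (γ u) (cr (γ v) (γ w)) := by
    rw [key]
    have := mul_pos (mul_pos (G.pos u v huv) (G.pos v w hvw)) (G.pos w u huw.symm)
    have := mul_pos (mul_pos (G.pos u w huw) (G.pos v u huv.symm)) (G.pos w v hvw.symm)
    linarith
  have hcr : dt (φ u) (cr (φ v) (φ w)) • p = dt (φ u) p • cr (φ v) (φ w) +
      dt (φ v) p • cr (φ w) (φ u) + dt (φ w) p • cr (φ u) (φ v) := by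
    ext i
    fin_cases i <;> simp [dt, cr] <;> ring
  rw [h1, h2, h3] at hcr
  simp only [zero_smul, add_zero, smul_eq_zero] at hcr
  rcases hcr with h | h
  · rw [h] at hpos; simp at hpos
  · exact hp h

theorem Geo.tang (G : Geo γ φ) {v : E3} {a b : Circle} (ha : dt (φ a) v < 0) (hb : 0 < dt (φ b) v) :
    ∃ u w, dt (φ u) v = 0 ∧ dt (φ w) v = 0 ∧ 0 < ori a u b ∧ ori a w b < 0 ∧
      ∀ x, dt (φ x) v = 0 → x = u ∨ x = w := by
  have hv : v ≠ 0 := by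
    rintro rfl
    rw [dt_zero] at ha
    exact lt_irrefl _ ha
  have hc : Continuous (fun x => dt (φ x) v) := dt_cont.comp (G.cφ.prodMk continuous_const)
  obtain ⟨u, w, hu, hw, hu1, hw1⟩ := circle_ivt _ hc a b ha hb
  refine ⟨u, w, hu, hw, hu1, hw1, ?_⟩
  intro x hx
  by_contra hcon
  push Not at hcon
  have huw : u ≠ w := by rintro rfl; linarith
  exact G.concur hcon.1 hcon.2 huw hv hx hu hw

theorem Geo.ends (G : Geo γ φ) {v : E3} {a b : Circle} {s t : ℝ} (hab : a ≠ b) (hs : 0 < s) (ht : 0 < t)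
    (hv : v = s • γ a - t • γ b) : dt (φ a) v < 0 ∧ 0 < dt (φ b) v := by
  have h1 := mul_pos ht (G.pos a b hab)
  have h2 := mul_pos hs (G.pos b a hab.symm)
  rw [hv]
  simp only [dt_sub, dt_smul, G.z]
  constructor <;> linarith

theorem Geo.fiber (G : Geo γ φ) {v n : E3} {a b : Circle} {s t : ℝ} (hab : a ≠ b) (hs : 0 < s)
    (ht : 0 < t) (hv : v = s • γ a - t • γ b) (hn : n ≠ 0) (hna : dt n (γ a) = 0)
    (hnb : dt n (γ b) = 0) :
    ∃ a b u w, ori a u w < 0 ∧ ori b w u < 0 ∧ (∀ x, dt n (γ x) = 0 ↔ x = a ∨ x = b) ∧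
      (∀ x, dt (φ x) v = 0 ↔ x = u ∨ x = w) := by
  obtain ⟨h1, h2⟩ := G.ends hab hs ht hv
  obtain ⟨u, w, hu, hw, hu1, hw1, huw⟩ := G.tang h1 h2
  have hsep := ori_sep a b u w hab (by nlinarith)
  have A : ∀ x, dt n (γ x) = 0 ↔ x = a ∨ x = b := by
    intro x
    constructor
    · intro hx
      by_contra hcon
      push Not at hcon
      exact G.col n hn x a b hcon.1 hcon.2 hab hx hna hnb
    · rintro (rfl | rfl) <;> assumption
  have B : ∀ x, dt (φ x) v = 0 ↔ x = u ∨ x = w := by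
    intro x
    constructor
    · exact huw x
    · rintro (rfl | rfl) <;> assumption
  rcases lt_or_ge (ori a u w) 0 with h | h
  · refine ⟨a, b, u, w, h, ?_, A, B⟩
    rw [ori_swap]
    nlinarith
  · refine ⟨a, b, w, u, ?_, ?_, A, fun x => (B x).trans or_comm⟩
    · rw [ori_swap]
      rcases h.eq_or_lt with h0 | h0
      · rw [← h0] at hsep; simp at hsep
      · linarith
    · nlinarith

abbrev TP := {t : Circle × Circle × Circle // PosOriented t.1 t.2.1 t.2.2}

/-- specification of the map `w` -/
def WSpec (γ φ : Circle → E3) (W : TP → Circle) : Prop :=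
  ∀ t : TP, W t ≠ t.1.2.1 ∧
    dt (φ t.1.1) (γ (W t)) * dt (φ t.1.2.2) (γ t.1.2.1) =
      dt (φ t.1.2.2) (γ (W t)) * dt (φ t.1.1) (γ t.1.2.1) ∧ ori t.1.1 (W t) t.1.2.2 < 0

theorem TP.ne (t : TP) : t.1.1 ≠ t.1.2.1 ∧ t.1.2.1 ≠ t.1.2.2 ∧ t.1.1 ≠ t.1.2.2 :=
  ori_ne' ((pos_iff _ _ _).mp t.2).ne'

theorem Geo.exists_W (G : Geo γ φ) : ∃ W, WSpec γ φ W := by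
  have : ∀ t : TP, ∃ w, w ≠ t.1.2.1 ∧
    dt (φ t.1.1) (γ w) * dt (φ t.1.2.2) (γ t.1.2.1) =
      dt (φ t.1.2.2) (γ w) * dt (φ t.1.1) (γ t.1.2.1) ∧ ori t.1.1 w t.1.2.2 < 0 := by
    intro t
    obtain ⟨h1, h2, h3⟩ := t.ne
    obtain ⟨w, hw, hr, ho⟩ := G.exists_w h1 h2 h3
    refine ⟨w, hw, hr, ?_⟩
    have := (pos_iff _ _ _).mp t.2
    by_contra hc
    push Not at hc
    nlinarith
  choose W hW using this
  exact ⟨W, hW⟩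

theorem ultra_lim {α : Type*} (𝒰 : Ultrafilter α) (f : α → Circle) : ∃ a, Tendsto f 𝒰 (𝓝 a) := by
  obtain ⟨a, -, ha⟩ := isCompact_univ.ultrafilter_le_nhds (𝒰.map f) (by simp)
  exact ⟨a, ha⟩

theorem Geo.W_cont (G : Geo γ φ) {W : TP → Circle} (hW : WSpec γ φ W) : Continuous W := by
  rw [continuous_iff_ultrafilter]
  intro t 𝒰 h𝒰
  obtain ⟨w, hw⟩ := ultra_lim 𝒰 W
  have hx : Tendsto (fun t : TP => t.1.1) 𝒰 (𝓝 t.1.1) :=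
    (Continuous.tendsto (by fun_prop) t).mono_left h𝒰
  have hy : Tendsto (fun t : TP => t.1.2.1) 𝒰 (𝓝 t.1.2.1) :=
    (Continuous.tendsto (by fun_prop) t).mono_left h𝒰
  have hz : Tendsto (fun t : TP => t.1.2.2) 𝒰 (𝓝 t.1.2.2) :=
    (Continuous.tendsto (by fun_prop) t).mono_left h𝒰
  have e1 := (G.tendsto hx hw).mul (G.tendsto hz hy)
  have e2 := (G.tendsto hz hw).mul (G.tendsto hx hy)
  have e : dt (φ t.1.1) (γ w) * dt (φ t.1.2.2) (γ t.1.2.1) =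
      dt (φ t.1.2.2) (γ w) * dt (φ t.1.1) (γ t.1.2.1) := by
    refine tendsto_nhds_unique e1 (e2.congr fun s => ?_)
    exact (hW s).2.1.symm
  have ho : ori t.1.1 w t.1.2.2 ≤ 0 := le_of_tendsto' (ori_tendsto hx hw hz) fun s => (hW s).2.2.le
  have hwy : w ≠ t.1.2.1 := by
    rintro rfl
    have := (pos_iff _ _ _).mp t.2
    linarith
  have : w = W t := G.w_unique t.ne.2.1 t.ne.2.2 hwy (hW t).1 e (hW t).2.1
  rw [← this]
  exact hw

/-- the properness statement -/
theorem Geo.proper (G : Geo γ φ) {W : TP → Circle} (hW : WSpec γ φ W) (𝒰 : Ultrafilter TP)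
    {v0 n0 : E3} {a b : Circle} {s t : ℝ} (hab : a ≠ b) (hs : 0 < s)
    (ht : 0 < t) (hv0 : v0 = s • γ a - t • γ b) (hn0 : n0 ≠ 0) (hna : dt n0 (γ a) = 0)
    (hnb : dt n0 (γ b) = 0) (v n : TP → E3) (hv : Tendsto v 𝒰 (𝓝 v0)) (hn : Tendsto n 𝒰 (𝓝 n0))
    (h1 : ∀ t, dt (φ (W t)) (v t) = 0) (h2 : ∀ t, dt (φ t.1.2.2) (v t) = 0)
    (h3 : ∀ t, dt (n t) (γ t.1.1) = 0) :
    ∃ t0 : TP, (𝒰 : Filter TP) ≤ 𝓝 t0 ∧ dt (φ (W t0)) v0 = 0 ∧ dt (φ t0.1.2.2) v0 = 0 ∧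
      dt n0 (γ t0.1.1) = 0 := by
  obtain ⟨x, hx⟩ := ultra_lim 𝒰 (fun t : TP => t.1.1)
  obtain ⟨y, hy⟩ := ultra_lim 𝒰 (fun t : TP => t.1.2.1)
  obtain ⟨z, hz⟩ := ultra_lim 𝒰 (fun t : TP => t.1.2.2)
  obtain ⟨w, hw⟩ := ultra_lim 𝒰 W
  obtain ⟨ea, eb⟩ := G.ends hab hs ht hv0
  have ew : dt (φ w) v0 = 0 := by
    refine tendsto_nhds_unique (dt_tendsto ((G.cφ.tendsto w).comp hw) hv) ?_
    refine tendsto_const_nhds.congr fun i => (h1 i).symm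
  have ez : dt (φ z) v0 = 0 := by
    refine tendsto_nhds_unique (dt_tendsto ((G.cφ.tendsto z).comp hz) hv) ?_
    refine tendsto_const_nhds.congr fun i => (h2 i).symm
  have ex : dt n0 (γ x) = 0 := by
    refine tendsto_nhds_unique (dt_tendsto hn ((G.cγ.tendsto x).comp hx)) ?_
    refine tendsto_const_nhds.congr fun i => (h3 i).symm
  have hwa : w ≠ a := by rintro rfl; linarith
  have hwb : w ≠ b := by rintro rfl; linarith
  have hza : z ≠ a := by rintro rfl; linarith
  have hzb : z ≠ b := by rintro rfl; linarith
  have hxab : x = a ∨ x = b := by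
    by_contra hcon
    push Not at hcon
    exact G.col n0 hn0 x a b hcon.1 hcon.2 hab ex hna hnb
  have hwx : w ≠ x := by rcases hxab with rfl | rfl <;> assumption
  have hzx : z ≠ x := by rcases hxab with rfl | rfl <;> assumption
  have hwz : w ≠ z := by
    have ta : ∀ᶠ i in (𝒰 : Filter TP), dt (φ a) (v i) < 0 :=
      (dt_tendsto tendsto_const_nhds hv).eventually (gt_mem_nhds ea)
    have tb : ∀ᶠ i in (𝒰 : Filter TP), 0 < dt (φ b) (v i) :=
      (dt_tendsto tendsto_const_nhds hv).eventually (lt_mem_nhds eb)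
    have hle : ori a w b * ori a z b ≤ 0 := by
      refine le_of_tendsto ((ori_tendsto tendsto_const_nhds hw tendsto_const_nhds).mul
        (ori_tendsto tendsto_const_nhds hz tendsto_const_nhds)) ?_
      filter_upwards [ta, tb] with i hia hib
      obtain ⟨p, q, -, -, hp1, hq1, hpq⟩ := G.tang hia hib
      have hne : W i ≠ i.1.2.2 := (ori_ne' (hW i).2.2.ne).2.1
      rcases hpq _ (h1 i) with e | e <;> rcases hpq _ (h2 i) with e' | e'
      · exact absurd (e.trans e'.symm) hne
      · rw [e, e']; nlinarith
      · rw [e, e']; nlinarith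
      · exact absurd (e.trans e'.symm) hne
    rintro rfl
    have := ori_ne a w b hwa.symm hwb hab
    have := mul_self_pos.mpr this
    linarith
  have e1 := (G.tendsto hx hw).mul (G.tendsto hz hy)
  have e2 := (G.tendsto hz hw).mul (G.tendsto hx hy)
  have e : dt (φ x) (γ w) * dt (φ z) (γ y) = dt (φ z) (γ w) * dt (φ x) (γ y) := by
    refine tendsto_nhds_unique e1 (e2.congr fun s => ?_)
    exact (hW s).2.1.symm
  have e' : dt (φ x) (γ y) * dt (φ z) (γ w) = dt (φ z) (γ y) * dt (φ x) (γ w) := by linarith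
  obtain ⟨hyx, hyz⟩ := G.w_ne hwx.symm hwz hzx.symm e'
  have ho : 0 ≤ ori x y z :=
    ge_of_tendsto' (ori_tendsto hx hy hz) fun s => ((pos_iff _ _ _).mp s.2).le
  have ho' : ori x w z ≤ 0 := le_of_tendsto' (ori_tendsto hx hw hz) fun s => (hW s).2.2.le
  have hpos : 0 < ori x y z := lt_of_le_of_ne ho (ori_ne x y z hyx.symm hyz hzx.symm).symm
  let t0 : TP := ⟨(x, y, z), (pos_iff _ _ _).mpr hpos⟩
  have hwy : w ≠ y := by rintro rfl; linarith
  have hWt : w = W t0 := G.w_unique hyz hzx.symm hwy (hW t0).1 e (hW t0).2.1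
  refine ⟨t0, ?_, ?_, ez, ex⟩
  · have : Tendsto id (𝒰 : Filter TP) (𝓝 t0) :=
      tendsto_subtype_rng.mpr (hx.prodMk_nhds (hy.prodMk_nhds hz))
    exact this
  · rw [← hWt]; exact ew

end geo

abbrev P3 := ℙ ℝ E3

structure Setup (C : Set P3) (f : E3 →ₗ[ℝ] ℝ) (ξ₁ : Circle → P3)
    (ξ₂ : Circle → Submodule ℝ E3) : Prop where
  hCo : IsOpen C
  hf : ∀ (v : E3) (hv : v ≠ 0), Projectivization.mk ℝ v hv ∈ closure C → f v ≠ 0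
  hconv : Convex ℝ {w : E3 | f w = 1 ∧ ∃ hw : w ≠ 0, Projectivization.mk ℝ w hw ∈ C}
  hstrict : StrictlyConvexBoundary C
  hC1 : ∀ p ∈ frontier C, ∃! W : Submodule ℝ E3, IsSupportingLineAt C W p
  hξ₁ : ∃ e : Circle ≃ₜ frontier C, ∀ x, (e x : P3) = ξ₁ x
  hξ₂ : ∀ x, IsSupportingLineAt C (ξ₂ x) (ξ₁ x)

def inC (C : Set P3) (v : E3) : Prop := ∃ hv : v ≠ 0, Projectivization.mk ℝ v hv ∈ C

theorem isOpen_inC {C : Set P3} (hC : IsOpen C) : IsOpen {v | inC C v} := by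
  have h1 : IsOpen {v : E3 | v ≠ 0} := isOpen_ne
  have h2 : IsOpen ((Projectivization.mk' ℝ : {v : E3 // v ≠ 0} → P3) ⁻¹' C) := hC.preimage mk_cont
  convert h1.isOpenMap_subtype_val _ h2 using 1
  ext v
  constructor
  · rintro ⟨hv, h⟩
    exact ⟨⟨v, hv⟩, h, rfl⟩
  · rintro ⟨⟨w, hw⟩, h, rfl⟩
    exact ⟨hw, h⟩

theorem inC_smul {C : Set P3} {v : E3} {c : ℝ} (hc : c ≠ 0) (h : inC C v) : inC C (c • v) := by
  obtain ⟨hv, h⟩ := h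
  refine ⟨smul_ne_zero hc hv, ?_⟩
  have : Projectivization.mk ℝ (c • v) (smul_ne_zero hc hv) = Projectivization.mk ℝ v hv := by
    rw [Projectivization.mk_eq_mk_iff']
    exact ⟨c, rfl⟩
  rwa [this]

theorem inC_rep {C : Set P3} {p : P3} : inC C p.rep ↔ p ∈ C := by
  constructor
  · rintro ⟨hv, h⟩
    rwa [Projectivization.mk_rep] at h
  · intro h
    exact ⟨p.rep_nonzero, by rwa [Projectivization.mk_rep]⟩

theorem P3_compact : CompactSpace P3 := by
  constructor
  have hne : ∀ v : Metric.sphere (0 : E3) 1, (v : E3) ≠ 0 := by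
    intro v h
    have := v.2
    rw [h] at this
    simp at this
  have hc : Continuous (fun v : Metric.sphere (0 : E3) 1 => Projectivization.mk ℝ (v : E3) (hne v)) := by
    rw [continuous_iff_continuousAt]
    intro v
    exact mk_tendsto hne (hne v) continuous_subtype_val.continuousAt
  have : CompactSpace (Metric.sphere (0 : E3) 1) := isCompact_iff_compactSpace.mp (isCompact_sphere _ _)
  convert isCompact_range hc
  symm
  rw [Set.eq_univ_iff_forall]
  intro p
  have hp : ‖p.rep‖ ≠ 0 := norm_ne_zero_iff.mpr p.rep_nonzero
  refine ⟨⟨‖p.rep‖⁻¹ • p.rep, ?_⟩, ?_⟩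
  · rw [mem_sphere_zero_iff_norm, norm_smul, norm_inv, norm_norm, inv_mul_cancel₀ hp]
  · conv_rhs => rw [← Projectivization.mk_rep p]
    rw [Projectivization.mk_eq_mk_iff']
    exact ⟨‖p.rep‖⁻¹, rfl⟩

theorem lin_cont (f : E3 →ₗ[ℝ] ℝ) : Continuous f := f.continuous_of_finiteDimensional

theorem dt_ext {u v : E3} (h : ∀ w, dt u w = dt v w) : u = v := by
  by_contra hne
  have := dt_self_pos (sub_ne_zero.mpr hne)
  rw [sub_dt, h, sub_self] at this
  exact lt_irrefl _ this

section setup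
variable {C : Set P3} {f : E3 →ₗ[ℝ] ℝ} {ξ₁ : Circle → P3} {ξ₂ : Circle → Submodule ℝ E3}

/-- affine picture of a set -/
def aff (f : E3 →ₗ[ℝ] ℝ) (C : Set P3) : Set E3 := {w | f w = 1 ∧ inC C w}

theorem Setup.convA (S : Setup C f ξ₁ ξ₂) : Convex ℝ (aff f C) := S.hconv

theorem Setup.sec_at (S : Setup C f ξ₁ ξ₂) {p : P3} (hp : p ∈ closure C) : ContinuousAt (sec f) p := by
  have h0 : f p.rep ≠ 0 := S.hf _ p.rep_nonzero (by rwa [Projectivization.mk_rep])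
  have := sec_tendsto f (lin_cont f) p.rep p.rep_nonzero h0
  rw [Projectivization.mk_rep] at this
  exact this

theorem Setup.f_sec (S : Setup C f ξ₁ ξ₂) {p : P3} (hp : p ∈ closure C) : f (sec f p) = 1 := by
  have h0 : f p.rep ≠ 0 := S.hf _ p.rep_nonzero (by rwa [Projectivization.mk_rep])
  unfold sec
  rw [map_smul, smul_eq_mul, inv_mul_cancel₀ h0]

theorem Setup.sec_in (S : Setup C f ξ₁ ξ₂) {p : P3} (hp : p ∈ closure C) {C' : Set P3} :
    inC C' (sec f p) ↔ p ∈ C' := by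
  have h0 : f p.rep ≠ 0 := S.hf _ p.rep_nonzero (by rwa [Projectivization.mk_rep])
  constructor
  · intro h
    have := inC_smul h0 h
    unfold sec at this
    rw [smul_smul, mul_inv_cancel₀ h0, one_smul] at this
    exact inC_rep.mp this
  · intro h
    exact inC_smul (inv_ne_zero h0) (inC_rep.mpr h)

theorem sec_self {v : E3} (hv : v ≠ 0) (h : f v = 1) : sec f (Projectivization.mk ℝ v hv) = v := by
  rw [sec_mk, h, inv_one, one_smul]

theorem Setup.aff_closure (S : Setup C f ξ₁ ξ₂) : aff f (closure C) = closure (aff f C) := by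
  apply Set.Subset.antisymm
  · rintro v ⟨h1, hv, h2⟩
    have h3 := mem_closure_image (S.sec_at h2) h2
    rw [sec_self hv h1] at h3
    refine closure_mono ?_ h3
    rintro _ ⟨p, hp, rfl⟩
    exact ⟨S.f_sec (subset_closure hp), (S.sec_in (subset_closure hp)).mpr hp⟩
  · intro v hv
    have hcl : IsClosed ({w : E3 | f w = 1} ∩ {w | inC (closure C)ᶜ w}ᶜ) :=
      (isClosed_eq (lin_cont f) continuous_const).inter
        (isOpen_inC isClosed_closure.isOpen_compl).isClosed_compl
    have hsub : aff f C ⊆ {w : E3 | f w = 1} ∩ {w | inC (closure C)ᶜ w}ᶜ := by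
      rintro w ⟨h1, hw, h2⟩
      exact ⟨h1, fun ⟨_, h⟩ => h (subset_closure h2)⟩
    obtain ⟨h1, h2⟩ := closure_minimal hsub hcl hv
    have hv0 : v ≠ 0 := by
      rintro rfl
      simp at h1
    refine ⟨h1, hv0, ?_⟩
    by_contra h
    exact h2 ⟨hv0, h⟩

theorem Setup.aff_compact (S : Setup C f ξ₁ ξ₂) : IsCompact (aff f (closure C)) := by
  have := P3_compact
  have h1 : IsCompact (closure C) := isClosed_closure.isCompact
  have h2 : ContinuousOn (sec f) (closure C) := fun p hp => (S.sec_at hp).continuousWithinAt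
  convert h1.image_of_continuousOn h2 using 1
  ext v
  constructor
  · rintro ⟨h, hv, hc⟩
    exact ⟨_, hc, sec_self hv h⟩
  · rintro ⟨p, hp, rfl⟩
    exact ⟨S.f_sec hp, (S.sec_in hp).mpr hp⟩

theorem Setup.open_line (S : Setup C f ξ₁ ξ₂) {w d : E3} (hw : w ∈ aff f C) (hd : f d = 0) :
    ∀ᶠ ε : ℝ in 𝓝 0, w + ε • d ∈ aff f C := by
  have hc : Continuous (fun ε : ℝ => w + ε • d) := by fun_prop
  have h1 : {v | inC C v} ∈ 𝓝 (w + (0 : ℝ) • d) := by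
    rw [zero_smul, add_zero]
    exact (isOpen_inC S.hCo).mem_nhds hw.2
  filter_upwards [hc.continuousAt.preimage_mem_nhds h1] with ε hε
  exact ⟨by rw [map_add, map_smul, hd, hw.1]; simp, hε⟩

theorem Setup.open_line' (S : Setup C f ξ₁ ξ₂) {w d : E3} (hw : w ∈ aff f C) (hd : f d = 0) :
    ∃ ε : ℝ, 0 < ε ∧ w + ε • d ∈ aff f C ∧ w - ε • d ∈ aff f C := by
  have h1 := S.open_line hw hd
  have h2 := S.open_line hw (d := -d) (by rw [map_neg, hd, neg_zero])
  obtain ⟨ε, ⟨h3, h4⟩, h5⟩ := ((h1.and h2).filter_mono nhdsWithin_le_nhds |>.and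
    (self_mem_nhdsWithin : Set.Ioi (0 : ℝ) ∈ 𝓝[>] (0 : ℝ))).exists
  refine ⟨ε, h5, h3, ?_⟩
  rw [smul_neg] at h4
  rwa [sub_eq_add_neg]

/-- lifted boundary -/
def gam (f : E3 →ₗ[ℝ] ℝ) (ξ₁ : Circle → P3) (x : Circle) : E3 := sec f (ξ₁ x)

theorem Setup.fr (S : Setup C f ξ₁ ξ₂) (x : Circle) : ξ₁ x ∈ frontier C := by
  obtain ⟨e, he⟩ := S.hξ₁
  rw [← he]
  exact (e x).2

theorem Setup.cl (S : Setup C f ξ₁ ξ₂) (x : Circle) : ξ₁ x ∈ closure C :=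
  frontier_subset_closure (S.fr x)

theorem Setup.notC (S : Setup C f ξ₁ ξ₂) (x : Circle) : ξ₁ x ∉ C := by
  have := (S.fr x).2
  rwa [S.hCo.interior_eq] at this

theorem Setup.gam_cont (S : Setup C f ξ₁ ξ₂) : Continuous (gam f ξ₁) := by
  obtain ⟨e, he⟩ := S.hξ₁
  have h1 : Continuous ξ₁ := by
    have : ξ₁ = fun x => (e x : P3) := funext fun x => (he x).symm
    rw [this]
    exact continuous_subtype_val.comp e.continuous
  rw [continuous_iff_continuousAt]
  intro x
  exact ContinuousAt.comp (S.sec_at (S.cl x)) h1.continuousAt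

theorem Setup.gam_mem (S : Setup C f ξ₁ ξ₂) (x : Circle) : gam f ξ₁ x ∈ aff f (closure C) :=
  ⟨S.f_sec (S.cl x), (S.sec_in (S.cl x)).mpr (S.cl x)⟩

theorem Setup.gam_ne (S : Setup C f ξ₁ ξ₂) (x : Circle) : gam f ξ₁ x ≠ 0 := (S.gam_mem x).2.1

theorem Setup.gam_mk (S : Setup C f ξ₁ ξ₂) (x : Circle) :
    Projectivization.mk ℝ (gam f ξ₁ x) (S.gam_ne x) = ξ₁ x := by
  obtain ⟨h, h'⟩ := (S.sec_in (S.cl x) (C' := {ξ₁ x})).mpr rfl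
  exact h'

theorem Setup.gam_sub (S : Setup C f ξ₁ ξ₂) (x : Circle) :
    (ξ₁ x).submodule = Submodule.span ℝ {gam f ξ₁ x} := by
  rw [← S.gam_mk x, Projectivization.submodule_mk]

theorem Setup.gam_surj (S : Setup C f ξ₁ ξ₂) {v : E3} (h : v ∈ aff f (closure C)) (h' : v ∉ aff f C) :
    ∃ x, gam f ξ₁ x = v := by
  obtain ⟨e, he⟩ := S.hξ₁
  obtain ⟨h1, hv, h2⟩ := h
  have hfr : Projectivization.mk ℝ v hv ∈ frontier C := by
    refine ⟨h2, ?_⟩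
    rw [S.hCo.interior_eq]
    exact fun hc => h' ⟨h1, hv, hc⟩
  obtain ⟨x, hx⟩ := e.surjective ⟨_, hfr⟩
  refine ⟨x, ?_⟩
  unfold gam
  rw [← he, hx]
  exact sec_self hv h1

theorem Setup.ξ_inj (S : Setup C f ξ₁ ξ₂) {x y : Circle} (h : ξ₁ x = ξ₁ y) : x = y := by
  obtain ⟨e, he⟩ := S.hξ₁
  rw [← he, ← he] at h
  exact e.injective (Subtype.ext h)

theorem Setup.nonempty (S : Setup C f ξ₁ ξ₂) : ∃ c, c ∈ aff f C := by
  have h1 : (closure C).Nonempty := ⟨_, S.cl 1⟩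
  obtain ⟨p, hp⟩ := closure_nonempty_iff.mp h1
  exact ⟨sec f p, S.f_sec (subset_closure hp), (S.sec_in (subset_closure hp)).mpr hp⟩

theorem finrank_ker_fnl {n : E3} (hn : n ≠ 0) : finrank ℝ (LinearMap.ker (fnl n)) = 2 := by
  have := Module.Dual.finrank_ker_add_one_of_ne_zero (fnl_ne hn)
  simp at this
  exact this

theorem Setup.col (S : Setup C f ξ₁ ξ₂) (n : E3) (hn : n ≠ 0) (x y z : Circle) (hxy : x ≠ y)
    (hxz : x ≠ z) (hyz : y ≠ z) (h1 : dt n (gam f ξ₁ x) = 0) (h2 : dt n (gam f ξ₁ y) = 0)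
    (h3 : dt n (gam f ξ₁ z) = 0) : False := by
  have key : ∀ x, dt n (gam f ξ₁ x) = 0 → (ξ₁ x).submodule ≤ LinearMap.ker (fnl n) := by
    intro x hx
    rw [S.gam_sub, Submodule.span_singleton_le_iff_mem]
    exact hx
  exact S.hstrict _ _ _ (S.fr x) (S.fr y) (S.fr z) (fun h => hxy (S.ξ_inj h)) (fun h => hxz (S.ξ_inj h))
    (fun h => hyz (S.ξ_inj h)) _ (finrank_ker_fnl hn) ⟨key x h1, key y h2, key z h3⟩

theorem Setup.ξ₂_ne (S : Setup C f ξ₁ ξ₂) {x : Circle} {v : E3} (hv : v ∈ aff f C) : v ∉ ξ₂ x := by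
  intro h
  have h0 := (S.hξ₂ x).2.2.2
  obtain ⟨h1, hv, h2⟩ := hv
  have : Projectivization.mk ℝ v hv ∈ projLine (ξ₂ x) ∩ C := by
    refine ⟨?_, h2⟩
    change (Projectivization.mk ℝ v hv).submodule ≤ _
    rw [Projectivization.submodule_mk, Submodule.span_singleton_le_iff_mem]
    exact h
  rw [h0] at this
  exact this

theorem Setup.exists_phi (S : Setup C f ξ₁ ξ₂) {c : E3} (hc : c ∈ aff f C) (x : Circle) :
    ∃ φ : E3, dt φ c = 1 ∧ ∀ v, v ∈ ξ₂ x ↔ dt φ v = 0 := by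
  have hlt : ξ₂ x < ⊤ := lt_top_iff_ne_top.mpr fun h => S.ξ₂_ne (x := x) hc (by rw [h]; trivial)
  obtain ⟨g, hg, hle⟩ := Submodule.exists_le_ker_of_lt_top _ hlt
  have hn := vec_ne hg
  have hfr := finrank_ker_fnl hn
  rw [fnl_vec] at hfr
  have heq : ξ₂ x = LinearMap.ker g :=
    Submodule.eq_of_le_of_finrank_eq hle ((S.hξ₂ x).1.trans hfr.symm)
  have hmem : ∀ v, v ∈ ξ₂ x ↔ dt (vec g) v = 0 := by
    intro v
    rw [heq, LinearMap.mem_ker, vec_apply]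
  have hc0 : dt (vec g) c ≠ 0 := fun h => S.ξ₂_ne hc ((hmem c).mpr h)
  refine ⟨(dt (vec g) c)⁻¹ • vec g, ?_, ?_⟩
  · rw [smul_dt, inv_mul_cancel₀ hc0]
  · intro v
    rw [hmem, smul_dt, mul_eq_zero]
    simp [hc0]

theorem Setup.pos_of (S : Setup C f ξ₁ ξ₂) {c : E3} (hc : c ∈ aff f C) {ψ : E3} (h1 : dt ψ c = 1)
    (h0 : ∀ v ∈ aff f C, dt ψ v ≠ 0) {v : E3} (hv : v ∈ aff f C) : 0 < dt ψ v := by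
  by_contra hcon
  have hlt : dt ψ v < 0 := lt_of_le_of_ne (not_lt.mp hcon) (h0 v hv)
  have hpos : 0 < 1 - dt ψ v := by linarith
  have hm := S.convA hc hv (a := -dt ψ v / (1 - dt ψ v)) (b := 1 / (1 - dt ψ v))
    (div_nonneg (by linarith) hpos.le) (by positivity) (by field_simp; ring)
  apply h0 _ hm
  rw [dt_add, dt_smul, dt_smul, h1]
  field_simp
  ring

/-- uniqueness of the supporting functional -/
theorem Setup.uniq (S : Setup C f ξ₁ ξ₂) {c : E3} {x : Circle} {φ : E3}
    (hφ : dt φ c = 1 ∧ ∀ v, v ∈ ξ₂ x ↔ dt φ v = 0) {ψ : E3} (hψ : ψ ≠ 0)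
    (h1 : dt ψ (gam f ξ₁ x) = 0) (h0 : ∀ v ∈ aff f C, dt ψ v ≠ 0) : ψ = dt ψ c • φ := by
  have hsup : IsSupportingLineAt C (LinearMap.ker (fnl ψ)) (ξ₁ x) := by
    refine ⟨finrank_ker_fnl hψ, S.fr x, ?_, ?_⟩
    · rw [S.gam_sub, Submodule.span_singleton_le_iff_mem]
      exact h1
    · rw [Set.eq_empty_iff_forall_notMem]
      rintro p ⟨hp, hpC⟩
      have hpc := subset_closure hpC
      refine h0 (sec f p) ⟨S.f_sec hpc, (S.sec_in hpc).mpr hpC⟩ ?_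
      exact hp (sec_mem f p)
  have heq : LinearMap.ker (fnl ψ) = ξ₂ x := (S.hC1 _ (S.fr x)).unique hsup (S.hξ₂ x)
  apply dt_ext
  intro v
  have hm : v - dt φ v • c ∈ ξ₂ x := by
    rw [hφ.2, dt_sub, dt_smul, hφ.1]; ring
  rw [← heq] at hm
  have : dt ψ (v - dt φ v • c) = 0 := hm
  rw [dt_sub, dt_smul] at this
  rw [smul_dt]
  linarith

end setup

section setup2
variable {C : Set P3} {f : E3 →ₗ[ℝ] ℝ} {ξ₁ : Circle → P3} {ξ₂ : Circle → Submodule ℝ E3}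

/-- the normalised supporting functionals -/
def PhiSpec (ξ₂ : Circle → Submodule ℝ E3) (c : E3) (φ : Circle → E3) : Prop :=
  ∀ x, dt (φ x) c = 1 ∧ ∀ v, v ∈ ξ₂ x ↔ dt (φ x) v = 0

theorem Setup.phi_z (S : Setup C f ξ₁ ξ₂) {c : E3} {φ : Circle → E3} (P : PhiSpec ξ₂ c φ)
    (x : Circle) : dt (φ x) (gam f ξ₁ x) = 0 := by
  rw [← (P x).2]
  have := (S.hξ₂ x).2.2.1
  rwa [S.gam_sub, Submodule.span_singleton_le_iff_mem] at this

theorem Setup.phi_pos (S : Setup C f ξ₁ ξ₂) {c : E3} (hc : c ∈ aff f C) {φ : Circle → E3}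
    (P : PhiSpec ξ₂ c φ) (x : Circle) {v : E3} (hv : v ∈ aff f C) : 0 < dt (φ x) v :=
  S.pos_of hc (P x).1 (fun v hv h => S.ξ₂_ne hv (((P x).2 v).mpr h)) hv

theorem Setup.phi_nonneg (S : Setup C f ξ₁ ξ₂) {c : E3} (hc : c ∈ aff f C) {φ : Circle → E3}
    (P : PhiSpec ξ₂ c φ) (x : Circle) {v : E3} (hv : v ∈ aff f (closure C)) : 0 ≤ dt (φ x) v := by
  rw [S.aff_closure] at hv
  have hcl : IsClosed {v : E3 | 0 ≤ dt (φ x) v} :=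
    isClosed_le continuous_const (dt_cont.comp (continuous_const.prodMk continuous_id))
  exact closure_minimal (fun v hv => (S.phi_pos hc P x hv).le) hcl hv

theorem Setup.gam_inj (S : Setup C f ξ₁ ξ₂) {x y : Circle} (h : gam f ξ₁ x = gam f ξ₁ y) : x = y := by
  apply S.ξ_inj
  rw [← S.gam_mk x, ← S.gam_mk y]
  congr 1

theorem phi_ne {c : E3} {φ : Circle → E3} (P : PhiSpec ξ₂ c φ) (x : Circle) : φ x ≠ 0 := by
  intro h
  have := (P x).1
  rw [h, zero_dt] at this
  exact zero_ne_one this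

theorem Setup.D_pos (S : Setup C f ξ₁ ξ₂) {c : E3} (hc : c ∈ aff f C) {φ : Circle → E3}
    (P : PhiSpec ξ₂ c φ) (x y : Circle) (hxy : x ≠ y) : 0 < dt (φ x) (gam f ξ₁ y) := by
  refine lt_of_le_of_ne (S.phi_nonneg hc P x (S.gam_mem y)) ?_
  intro h0
  have hcv : Convex ℝ (aff f (closure C)) := by
    rw [S.aff_closure]; exact S.convA.closure
  have hm := hcv (S.gam_mem x) (S.gam_mem y) (a := 1/2) (b := 1/2) (by norm_num) (by norm_num)
    (by norm_num)
  have hz := S.phi_z P x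
  have hm0 : dt (φ x) ((1/2 : ℝ) • gam f ξ₁ x + (1/2 : ℝ) • gam f ξ₁ y) = 0 := by
    rw [dt_add, dt_smul, dt_smul, hz, ← h0]; ring
  obtain ⟨t, ht⟩ := S.gam_surj hm (fun h => S.ξ₂_ne h (((P x).2 _).mpr hm0))
  have hne : gam f ξ₁ x ≠ gam f ξ₁ y := fun h => hxy (S.gam_inj h)
  have hd : gam f ξ₁ y - gam f ξ₁ x ≠ 0 := sub_ne_zero.mpr hne.symm
  have e1 : x ≠ t := by
    rintro rfl
    apply hd
    have e : gam f ξ₁ y - gam f ξ₁ x = (2 : ℝ) • (((1/2 : ℝ) • gam f ξ₁ x + (1/2 : ℝ) • gam f ξ₁ y) - gam f ξ₁ x) := by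
      module
    rw [e, ← ht, sub_self, smul_zero]
  have e2 : y ≠ t := by
    rintro rfl
    apply hd
    have e : gam f ξ₁ y - gam f ξ₁ x = (2 : ℝ) • (gam f ξ₁ y - ((1/2 : ℝ) • gam f ξ₁ x + (1/2 : ℝ) • gam f ξ₁ y)) := by
      module
    rw [e, ← ht, sub_self, smul_zero]
  exact S.col (φ x) (phi_ne P x) x y t hxy e1 e2 hz h0.symm (by rw [ht]; exact hm0)

theorem Setup.phi_bdd (S : Setup C f ξ₁ ξ₂) {c : E3} (hc : c ∈ aff f C) {φ : Circle → E3}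
    (P : PhiSpec ξ₂ c φ) (e : E3) : ∃ M, ∀ x, |dt (φ x) e| ≤ M := by
  have hd : f (e - f e • c) = 0 := by
    rw [map_sub, map_smul, hc.1]; simp
  obtain ⟨ε, hε, h1, h2⟩ := S.open_line' hc hd
  refine ⟨|f e| + 1 / ε, fun x => ?_⟩
  have a1 := S.phi_pos hc P x h1
  have a2 := S.phi_pos hc P x h2
  rw [dt_add, dt_smul, (P x).1] at a1
  rw [dt_sub, dt_smul, (P x).1] at a2
  have a3 : |dt (φ x) (e - f e • c)| ≤ 1 / ε := by
    rw [abs_le, le_div_iff₀ hε, neg_le, ← sub_nonneg]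
    constructor
    · have : 1 / ε - -dt (φ x) (e - f e • c) = (1 + ε * dt (φ x) (e - f e • c)) / ε := by
        field_simp; ring
      rw [this]; positivity
    · nlinarith
  have a4 : dt (φ x) e = f e + dt (φ x) (e - f e • c) := by
    rw [dt_sub, dt_smul, (P x).1]; ring
  rw [a4]
  exact (abs_add_le _ _).trans (by linarith)

theorem Setup.phi_cont (S : Setup C f ξ₁ ξ₂) {c : E3} (hc : c ∈ aff f C) {φ : Circle → E3}
    (P : PhiSpec ξ₂ c φ) : Continuous φ := by
  rw [continuous_iff_ultrafilter]
  intro x 𝒰 h𝒰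
  have hb : ∀ i : Fin 3, ∃ M, ∀ x, |φ x i| ≤ M := by
    intro i
    obtain ⟨M, hM⟩ := S.phi_bdd hc P (Pi.single i 1)
    refine ⟨M, fun x => ?_⟩
    have : dt (φ x) (Pi.single i 1) = φ x i := by
      unfold dt
      fin_cases i <;> simp
    rw [← this]; exact hM x
  choose M hM using hb
  have hK : IsCompact (Set.univ.pi fun i : Fin 3 => Set.Icc (-M i) (M i)) :=
    isCompact_univ_pi fun i => isCompact_Icc
  obtain ⟨ψ, -, hψ⟩ := hK.ultrafilter_le_nhds (𝒰.map φ) (by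
    rw [le_principal_iff]
    change _ ∈ Filter.map φ (𝒰 : Filter Circle)
    rw [Filter.mem_map]
    exact Filter.univ_mem' fun x i _ => abs_le.mp (hM i x))
  have hψ' : Tendsto φ 𝒰 (𝓝 ψ) := hψ
  have hconst : ∀ v : E3, Tendsto (fun x => dt (φ x) v) 𝒰 (𝓝 (dt ψ v)) := fun v =>
    dt_tendsto hψ' tendsto_const_nhds
  have k1 : dt ψ c = 1 := tendsto_nhds_unique (hconst c) (by simp only [(P _).1]; exact tendsto_const_nhds)
  have k2 : dt ψ (gam f ξ₁ x) = 0 := by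
    refine tendsto_nhds_unique (dt_tendsto hψ' ((S.gam_cont.tendsto x).mono_left h𝒰)) ?_
    simp only [S.phi_z P]
    exact tendsto_const_nhds
  have k3 : ∀ v ∈ aff f C, 0 ≤ dt ψ v := fun v hv =>
    ge_of_tendsto' (hconst v) (fun x => (S.phi_pos hc P x hv).le)
  have k4 : ∀ v ∈ aff f C, dt ψ v ≠ 0 := by
    intro v hv h0
    obtain ⟨ε, hε, h1, -⟩ := S.open_line' hv (d := v - c) (by rw [map_sub, hv.1, hc.1, sub_self])
    have := k3 _ h1
    rw [dt_add, dt_smul, dt_sub, h0, k1] at this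
    linarith
  have k5 : ψ ≠ 0 := by
    rintro rfl
    rw [zero_dt] at k1
    exact zero_ne_one k1
  have := S.uniq (P x) k5 k2 k4
  rw [k1, one_smul] at this
  rw [← this]
  exact hψ

theorem Setup.geo (S : Setup C f ξ₁ ξ₂) {c : E3} (hc : c ∈ aff f C) {φ : Circle → E3}
    (P : PhiSpec ξ₂ c φ) : Geo (gam f ξ₁) φ where
  cγ := S.gam_cont
  cφ := S.phi_cont hc P
  z := S.phi_z P
  pos := S.D_pos hc P
  col := S.col

/-- scaling into the affine chart -/
theorem Setup.chart (S : Setup C f ξ₁ ξ₂) {p : P3} (hp : p ∈ closure C) {v : E3} (hv : v ≠ 0)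
    (h : Projectivization.mk ℝ v hv = p) : f v ≠ 0 ∧ (f v)⁻¹ • v ∈ aff f (closure C) := by
  subst h
  have h0 := S.hf v hv hp
  exact ⟨h0, by rw [map_smul, smul_eq_mul, inv_mul_cancel₀ h0], inC_smul (inv_ne_zero h0) ⟨hv, hp⟩⟩

theorem Setup.tangent_out (S : Setup C f ξ₁ ξ₂) {c : E3} (hc : c ∈ aff f C) {φ : Circle → E3}
    (P : PhiSpec ξ₂ c φ) {w z : Circle} (hwz : w ≠ z) {v : E3} (hv : v ≠ 0) (h1 : dt (φ w) v = 0)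
    (h2 : dt (φ z) v = 0) : Projectivization.mk ℝ v hv ∉ closure C := by
  intro hcl
  obtain ⟨h0, hm⟩ := S.chart hcl hv rfl
  have e1 : dt (φ w) ((f v)⁻¹ • v) = 0 := by rw [dt_smul, h1, mul_zero]
  have e2 : dt (φ z) ((f v)⁻¹ • v) = 0 := by rw [dt_smul, h2, mul_zero]
  obtain ⟨y, hy⟩ := S.gam_surj hm (fun h => S.ξ₂_ne h (((P w).2 _).mpr e1))
  rw [← hy] at e1 e2
  have a1 : w = y := by
    by_contra h
    exact (S.D_pos hc P w y h).ne' e1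
  have a2 : z = y := by
    by_contra h
    exact (S.D_pos hc P z y h).ne' e2
  exact hwz (a1.trans a2.symm)

theorem Setup.meets (S : Setup C f ξ₁ ξ₂) {c : E3} (hc : c ∈ aff f C) {φ : Circle → E3}
    (P : PhiSpec ξ₂ c φ) {x w z : Circle} (hxw : x ≠ w) (hxz : x ≠ z) (hwz : w ≠ z) :
    ∃ v ∈ aff f C, dt (dt (φ z) (gam f ξ₁ x) • φ w - dt (φ w) (gam f ξ₁ x) • φ z) v = 0 := by
  have G := S.geo hc P
  by_contra hcon
  push Not at hcon
  have hk := S.uniq (P x) (G.pencil_ne hxz hwz) (by rw [sub_dt, smul_dt, smul_dt]; ring) hcon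
  set k := dt (dt (φ z) (gam f ξ₁ x) • φ w - dt (φ w) (gam f ξ₁ x) • φ z) c
  have e1 := congrArg (fun u => dt u (gam f ξ₁ w)) hk
  have e2 := congrArg (fun u => dt u (gam f ξ₁ z)) hk
  simp only [sub_dt, smul_dt, G.z] at e1 e2
  have p1 := mul_pos (G.pos w x hxw.symm) (G.pos z w hwz.symm)
  have p2 := mul_pos (G.pos z x hxz.symm) (G.pos w z hwz)
  have p3 := G.pos x w hxw
  have p4 := G.pos x z hxz
  have c1 : k < 0 := by
    by_contra h
    push Not at h
    have := mul_nonneg h p3.le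
    linarith
  have := mul_neg_of_neg_of_pos c1 p4
  linarith

theorem Setup.chord_end (S : Setup C f ξ₁ ξ₂) {q d : E3} (hq : q ∈ aff f C) (hd : d ≠ 0)
    (hfd : f d = 0) : ∃ s : ℝ, 0 < s ∧ ∃ x, gam f ξ₁ x = q + s • d := by
  let T : Set ℝ := {s | q + s • d ∈ aff f (closure C)}
  have hT : IsCompact T := by
    have hemb : IsClosedEmbedding (fun s : ℝ => q + s • d) :=
      (Homeomorph.addLeft q).isClosedEmbedding.comp (isClosedEmbedding_smul_left hd)
    exact hemb.isCompact_preimage S.aff_compact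
  have hne : T.Nonempty := ⟨0, by
    change q + (0 : ℝ) • d ∈ aff f (closure C)
    rw [zero_smul, add_zero]
    exact ⟨hq.1, hq.2.1, subset_closure hq.2.2⟩⟩
  obtain ⟨s, hs, hmax⟩ := hT.exists_isGreatest hne
  have hs0 : 0 < s := by
    obtain ⟨ε, hε, h1, -⟩ := S.open_line' hq hfd
    have : ε ≤ s := hmax (⟨h1.1, h1.2.1, subset_closure h1.2.2⟩ : ε ∈ T)
    linarith
  refine ⟨s, hs0, S.gam_surj hs ?_⟩
  intro h
  obtain ⟨ε, hε, h1, -⟩ := S.open_line' h hfd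
  have : s + ε ≤ s := hmax (by
    change q + (s + ε) • d ∈ aff f (closure C)
    rw [add_smul, ← add_assoc]
    exact ⟨h1.1, h1.2.1, subset_closure h1.2.2⟩)
  linarith

theorem Setup.secant (S : Setup C f ξ₁ ξ₂) {pl : P3 × ℙ ℝ (Module.Dual ℝ (Fin 3 → ℝ))}
    (h : pl ∈ Omega2 C) : ∃ (a b : Circle) (s t : ℝ), a ≠ b ∧ 0 < s ∧ 0 < t ∧
      pl.1.rep = s • gam f ξ₁ a - t • gam f ξ₁ b ∧ dt (vec pl.2.rep) (gam f ξ₁ a) = 0 ∧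
      dt (vec pl.2.rep) (gam f ξ₁ b) = 0 := by
  obtain ⟨hF, hout, q, hqC, hq⟩ := h
  have hrep : pl.2.rep ∈ pl.2.submodule := by
    rw [Projectivization.submodule_eq]; exact Submodule.mem_span_singleton_self _
  have key : ∀ p : P3, p.submodule ≤ pl.2.submodule.dualCoannihilator → ∀ v ∈ p.submodule,
      dt (vec pl.2.rep) v = 0 := by
    intro p hp v hv
    have := hp hv
    rw [Submodule.mem_dualCoannihilator] at this
    rw [← vec_apply]
    exact this _ hrep
  have hqcl := subset_closure hqC
  have hqa : sec f q ∈ aff f C := ⟨S.f_sec hqcl, (S.sec_in hqcl).mpr hqC⟩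
  set v := pl.1.rep with hv
  have hv0 : v ≠ 0 := pl.1.rep_nonzero
  have hvn : dt (vec pl.2.rep) v = 0 := key pl.1 hF v (by
    rw [Projectivization.submodule_eq]; exact Submodule.mem_span_singleton_self _)
  have hqn : dt (vec pl.2.rep) (sec f q) = 0 := key q hq _ (sec_mem f q)
  have hnotin : ∀ k : ℝ, k ≠ 0 → k • v ∉ aff f (closure C) := by
    rintro k hk ⟨-, h1⟩
    have := inC_smul (inv_ne_zero hk) h1
    rw [smul_smul, inv_mul_cancel₀ hk, one_smul] at this
    exact hout (inC_rep.mp this)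
  set g := sec f q with hg
  have hfd : f (v - f v • g) = 0 := by rw [map_sub, map_smul, hqa.1]; simp
  have hd : v - f v • g ≠ 0 := by
    intro h0
    have e : v = f v • g := sub_eq_zero.mp h0
    have hfv : f v ≠ 0 := by
      intro h; rw [h, zero_smul] at e; exact hv0 e
    apply hnotin (f v)⁻¹ (inv_ne_zero hfv)
    have : (f v)⁻¹ • v = g := by
      rw [e, map_smul, hqa.1, smul_eq_mul, mul_one, smul_smul, inv_mul_cancel₀ hfv, one_smul]
    rw [this]
    exact ⟨hqa.1, hqa.2.1, subset_closure hqa.2.2⟩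
  obtain ⟨s, hs, b, hb⟩ := S.chord_end hqa hd hfd
  obtain ⟨r, hr, a, ha⟩ := S.chord_end hqa (neg_ne_zero.mpr hd) (by rw [map_neg, hfd, neg_zero])
  have hna : dt (vec pl.2.rep) (gam f ξ₁ a) = 0 := by
    rw [ha, dt_add, dt_smul, ← neg_one_smul ℝ, dt_smul, dt_sub, dt_smul, hvn, hqn]; ring
  have hnb : dt (vec pl.2.rep) (gam f ξ₁ b) = 0 := by
    rw [hb, dt_add, dt_smul, dt_sub, dt_smul, hvn, hqn]; ring
  have hsr : 0 < s + r := by linarith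
  have hab : a ≠ b := by
    rintro rfl
    rw [ha] at hb
    apply hd
    have e : (s + r) • (v - f v • g) = 0 := by
      have := sub_eq_zero.mpr hb.symm
      rw [← this]; module
    exact (smul_eq_zero.mp e).resolve_left hsr.ne'
  -- coefficients
  obtain ⟨α, β, hαβ⟩ : ∃ α β : ℝ, v = α • gam f ξ₁ a + β • gam f ξ₁ b := by
    refine ⟨(f v * s - 1) / (s + r), (f v * r + 1) / (s + r), ?_⟩
    have e : (s + r) • v = (f v * s - 1) • gam f ξ₁ a + (f v * r + 1) • gam f ξ₁ b := by
      rw [ha, hb]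
      module
    have e2 : v = (s + r)⁻¹ • ((s + r) • v) := by
      rw [smul_smul, inv_mul_cancel₀ hsr.ne', one_smul]
    refine e2.trans ?_
    rw [e, div_eq_inv_mul, div_eq_inv_mul, smul_add, smul_smul, smul_smul]
  have hcv : Convex ℝ (aff f (closure C)) := by
    rw [S.aff_closure]; exact S.convA.closure
  have hneg : α * β < 0 := by
    by_contra hcon
    push Not at hcon
    have hsum : α + β ≠ 0 := by
      intro h0
      have : α = 0 := by nlinarith
      have hb : β = 0 := by linarith
      rw [this, hb] at hαβ
      simp at hαβ
      exact hv0 hαβ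
    apply hnotin (α + β)⁻¹ (inv_ne_zero hsum)
    rw [hαβ, smul_add, smul_smul, smul_smul]
    have hsq : 0 < (α + β) ^ 2 := by positivity
    refine hcv (S.gam_mem a) (S.gam_mem b) ?_ ?_ (by field_simp)
    · have : (α + β)⁻¹ * α = (α * α + α * β) / (α + β) ^ 2 := by field_simp
      rw [this]
      exact div_nonneg (by nlinarith [mul_self_nonneg α]) hsq.le
    · have : (α + β)⁻¹ * β = (β * β + α * β) / (α + β) ^ 2 := by field_simp; ring
      rw [this]
      exact div_nonneg (by nlinarith [mul_self_nonneg β]) hsq.le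
  rcases mul_neg_iff.mp hneg with ⟨h1, h2⟩ | ⟨h1, h2⟩
  · exact ⟨a, b, α, -β, hab, h1, by linarith, by rw [hαβ]; module, hna, hnb⟩
  · exact ⟨b, a, β, -α, hab.symm, h2, by linarith, by rw [hαβ]; module, hnb, hna⟩

end setup2

section fibers
variable {γ φ : Circle → E3}

theorem Geo.tau (G : Geo γ φ) {W : TP → Circle} (hW : WSpec γ φ W) {x w z : Circle}
    (h : ori x w z < 0) : ∃ t : TP, t.1.1 = x ∧ t.1.2.2 = z ∧ W t = w := by
  obtain ⟨h1, h2, h3⟩ := ori_ne' h.ne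
  obtain ⟨y, hy, hr, ho⟩ := G.exists_w h1 h2 h3
  have hpos : 0 < ori x y z := by
    by_contra hc
    push Not at hc
    nlinarith
  obtain ⟨k1, k2, k3⟩ := ori_ne' hpos.ne'
  let t : TP := ⟨(x, y, z), (pos_iff _ _ _).mpr hpos⟩
  refine ⟨t, rfl, rfl, ?_⟩
  obtain ⟨a1, a2, -⟩ := hW t
  exact G.w_unique k2 k3 a1 hy.symm a2 (by linarith)

theorem Geo.TP_ext (G : Geo γ φ) {W : TP → Circle} (hW : WSpec γ φ W) {t t' : TP}
    (hx : t.1.1 = t'.1.1) (hz : t.1.2.2 = t'.1.2.2) (hw : W t = W t') : t = t' := by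
  obtain ⟨a1, a2, a3⟩ := hW t
  obtain ⟨b1, b2, b3⟩ := hW t'
  obtain ⟨k1, k2, k3⟩ := ori_ne' a3.ne
  rw [← hw] at b1 b2
  rw [← hx, ← hz] at b2
  have hy := G.w_unique k2 k3 a1.symm b1.symm (by linarith) (by linarith)
  apply Subtype.ext
  exact Prod.ext hx (Prod.ext hy hz)

def Sol (γ φ : Circle → E3) (W : TP → Circle) (v n : E3) : Set TP :=
  {t | dt (φ (W t)) v = 0 ∧ dt (φ t.1.2.2) v = 0 ∧ dt n (γ t.1.1) = 0}

theorem Geo.sol (G : Geo γ φ) {W : TP → Circle} (hW : WSpec γ φ W) {v n : E3} {a b : Circle}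
    {s t : ℝ} (hab : a ≠ b) (hs : 0 < s)
    (ht : 0 < t) (hv : v = s • γ a - t • γ b) (hn : n ≠ 0) (hna : dt n (γ a) = 0)
    (hnb : dt n (γ b) = 0) : ∃ t1 t2 u w, u ≠ w ∧ t1 ≠ t2 ∧ Sol γ φ W v n = {t1, t2} ∧
      W t1 = u ∧ t1.1.2.2 = w ∧ W t2 = w ∧ t2.1.2.2 = u := by
  obtain ⟨a, b, u, w, h1, h2, hA, hB⟩ := G.fiber hab hs ht hv hn hna hnb
  obtain ⟨t1, x1, z1, w1⟩ := G.tau hW h1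
  obtain ⟨t2, x2, z2, w2⟩ := G.tau hW h2
  have huw : u ≠ w := (ori_ne' h1.ne).2.1
  refine ⟨t1, t2, u, w, huw, ?_, ?_, w1, z1, w2, z2⟩
  · rintro rfl
    exact huw (w1.symm.trans w2)
  · ext t
    constructor
    · rintro ⟨e1, e2, e3⟩
      rw [hB] at e1 e2
      rw [hA] at e3
      have ho := (hW t).2.2
      have hne := (ori_ne' ho.ne).2.1
      have s1 := ori_swap a u w
      have s2 := ori_swap b w u
      rcases e1 with e1 | e1 <;> rcases e2 with e2 | e2
      · exact absurd (e1.trans e2.symm) hne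
      · left
        rcases e3 with e3 | e3
        · exact G.TP_ext hW (e3.trans x1.symm) (e2.trans z1.symm) (e1.trans w1.symm)
        · rw [e1, e2, e3] at ho
          linarith
      · right
        rcases e3 with e3 | e3
        · rw [e1, e2, e3] at ho
          linarith
        · exact G.TP_ext hW (e3.trans x2.symm) (e2.trans z2.symm) (e1.trans w2.symm)
      · exact absurd (e1.trans e2.symm) hne
    · rintro (rfl | rfl)
      · exact ⟨by rw [w1, hB]; simp, by rw [z1, hB]; simp, by rw [x1, hA]; simp⟩
      · exact ⟨by rw [w2, hB]; simp, by rw [z2, hB]; simp, by rw [x2, hA]; simp⟩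

theorem Geo.cn_ne (G : Geo γ φ) {x w z : Circle} (hxz : x ≠ z) (hwz : w ≠ z) :
    cr (cr (φ w) (φ z)) (γ x) ≠ 0 := by
  rw [cr_cr]
  intro h
  apply G.pencil_ne hxz hwz
  rw [← neg_sub, h, neg_zero]

theorem cr_zero_left (v : E3) : cr 0 v = 0 := by
  ext i
  fin_cases i <;> simp [cr]

theorem Geo.cp_ne (G : Geo γ φ) {x w z : Circle} (hxz : x ≠ z) (hwz : w ≠ z) :
    cr (φ w) (φ z) ≠ 0 := by
  intro h
  have := G.cn_ne hxz hwz
  rw [h, cr_zero_left] at this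
  exact this rfl

end fibers

theorem flag_iff {v n : E3} (hv : v ≠ 0) (hn : fnl n ≠ 0) :
    (Projectivization.mk ℝ v hv).submodule ≤
      (Projectivization.mk ℝ (fnl n) hn).submodule.dualCoannihilator ↔ dt n v = 0 := by
  rw [Projectivization.submodule_mk, Projectivization.submodule_mk,
    Submodule.span_singleton_le_iff_mem, Submodule.mem_dualCoannihilator]
  constructor
  · intro h
    exact h _ (Submodule.mem_span_singleton_self _)
  · intro h F hF
    obtain ⟨k, rfl⟩ := Submodule.mem_span_singleton.mp hF
    simp [fnl_apply, h]

theorem span_ann {p g : E3} (h : cr p g ≠ 0) : Submodule.span ℝ {fnl (cr p g)} =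
    (Submodule.span ℝ {p} ⊔ Submodule.span ℝ {g}).dualAnnihilator := by
  ext F
  rw [Submodule.dualAnnihilator_sup_eq, Submodule.mem_inf]
  have key : ∀ u : E3, F ∈ (Submodule.span ℝ {u}).dualAnnihilator ↔ dt u (vec F) = 0 := by
    intro u
    rw [Submodule.mem_dualAnnihilator, dt_comm, ← vec_apply]
    constructor
    · intro h
      exact h _ (Submodule.mem_span_singleton_self _)
    · intro h w hw
      obtain ⟨k, rfl⟩ := Submodule.mem_span_singleton.mp hw
      rw [map_smul, h, smul_zero]
  rw [key, key]
  constructor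
  · intro hF
    obtain ⟨k, rfl⟩ := Submodule.mem_span_singleton.mp hF
    rw [dt_comm p, dt_comm g, ← vec_apply, ← vec_apply]
    simp [fnl_apply, dt_comm _ p, dt_comm _ g, dt_cr_left, dt_cr_right]
  · rintro ⟨h1, h2⟩
    obtain ⟨k, hk⟩ := Submodule.mem_span_singleton.mp (mem_span_cr h h1 h2)
    rw [Submodule.mem_span_singleton]
    refine ⟨k, ?_⟩
    ext1 v
    ext
    rw [← fnl_vec F, ← hk]
    simp [fnl_apply, smul_dt]

theorem inf_eq {ξ₂ : Circle → Submodule ℝ E3} {c : E3} {φ : Circle → E3} (P : PhiSpec ξ₂ c φ)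
    {w z : Circle} (h : cr (φ w) (φ z) ≠ 0) :
    Submodule.span ℝ {cr (φ w) (φ z)} = ξ₂ w ⊓ ξ₂ z := by
  ext v
  rw [Submodule.mem_inf, (P w).2, (P z).2]
  constructor
  · intro hv
    obtain ⟨k, rfl⟩ := Submodule.mem_span_singleton.mp hv
    rw [dt_smul, dt_smul, dt_cr_left, dt_cr_right]
    simp
  · rintro ⟨h1, h2⟩
    exact mem_span_cr h h1 h2

section setup3
variable {C : Set P3} {f : E3 →ₗ[ℝ] ℝ} {ξ₁ : Circle → P3} {ξ₂ : Circle → Submodule ℝ E3}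

theorem Setup.w_iff (S : Setup C f ξ₁ ξ₂) {c : E3} (hc : c ∈ aff f C) {φ : Circle → E3}
    (P : PhiSpec ξ₂ c φ) {x y z w : Circle} (hxy : x ≠ y) :
    (ξ₁ w).submodule ≤ (ξ₁ y).submodule ⊔ (ξ₂ x ⊓ ξ₂ z) ↔
      dt (φ x) (gam f ξ₁ w) * dt (φ z) (gam f ξ₁ y) =
        dt (φ z) (gam f ξ₁ w) * dt (φ x) (gam f ξ₁ y) := by
  rw [S.gam_sub, S.gam_sub, Submodule.span_singleton_le_iff_mem, Submodule.mem_sup]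
  have hp := S.D_pos hc P x y hxy
  constructor
  · rintro ⟨u, hu, v, ⟨hv1, hv2⟩, huv⟩
    obtain ⟨k, rfl⟩ := Submodule.mem_span_singleton.mp hu
    have e1 := ((P x).2 v).mp hv1
    have e2 := ((P z).2 v).mp hv2
    rw [← huv, dt_add, dt_add, e1, e2, dt_smul, dt_smul]
    ring
  · intro h
    set k := dt (φ x) (gam f ξ₁ w) / dt (φ x) (gam f ξ₁ y) with hk
    refine ⟨k • gam f ξ₁ y, Submodule.smul_mem _ _ (Submodule.mem_span_singleton_self _),
      gam f ξ₁ w - k • gam f ξ₁ y, ⟨((P x).2 _).mpr ?_, ((P z).2 _).mpr ?_⟩, by abel⟩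
    · rw [dt_sub, dt_smul, hk]; field_simp; ring
    · rw [dt_sub, dt_smul, hk]; field_simp; linarith

theorem Setup.main (S : Setup C f ξ₁ ξ₂) : ∃ w : TP → Circle,
      (∀ t, w t ≠ t.1.2.1 ∧
        (ξ₁ (w t)).submodule ≤ (ξ₁ t.1.2.1).submodule ⊔ (ξ₂ t.1.1 ⊓ ξ₂ t.1.2.2) ∧
        (∀ w' : Circle, w' ≠ t.1.2.1 →
          (ξ₁ w').submodule ≤ (ξ₁ t.1.2.1).submodule ⊔ (ξ₂ t.1.1 ⊓ ξ₂ t.1.2.2) →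
          w' = w t) ∧
        w t ≠ t.1.1 ∧ w t ≠ t.1.2.2) ∧
      ∃ Φ : TP → ↥(Omega2 C),
        (∀ t, (Φ t : ℙ ℝ (Fin 3 → ℝ) × ℙ ℝ (Module.Dual ℝ (Fin 3 → ℝ))).1.submodule =
            ξ₂ (w t) ⊓ ξ₂ t.1.2.2) ∧
        (∀ t, (Φ t : ℙ ℝ (Fin 3 → ℝ) × ℙ ℝ (Module.Dual ℝ (Fin 3 → ℝ))).2.submodule =
            ((ξ₂ (w t) ⊓ ξ₂ t.1.2.2) ⊔ (ξ₁ t.1.1).submodule).dualAnnihilator) ∧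
        Function.Surjective Φ ∧
        IsCoveringMap Φ ∧
        (∀ b, (Φ ⁻¹' {b}).ncard = 2) := by
  obtain ⟨c, hc⟩ := S.nonempty
  choose φ P' using fun x => S.exists_phi hc x
  have P : PhiSpec ξ₂ c φ := P'
  have G := S.geo hc P
  obtain ⟨W, hW⟩ := G.exists_W
  have hWc := G.W_cont hW
  have hne : ∀ t : TP, t.1.1 ≠ W t ∧ W t ≠ t.1.2.2 ∧ t.1.1 ≠ t.1.2.2 := fun t =>
    ori_ne' (hW t).2.2.ne
  refine ⟨W, ?_, ?_⟩
  · intro t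
    obtain ⟨h1, h2, h3⟩ := hW t
    obtain ⟨k1, k2, k3⟩ := hne t
    obtain ⟨t1, t2, t3⟩ := t.ne
    refine ⟨h1, (S.w_iff hc P t1).mpr h2, ?_, k1.symm, k2⟩
    intro w' hw' hs
    exact G.w_unique t2 t3 hw' h1 ((S.w_iff hc P t1).mp hs) h2
  let p : TP → E3 := fun t => cr (φ (W t)) (φ t.1.2.2)
  let n : TP → E3 := fun t => cr (p t) (gam f ξ₁ t.1.1)
  have hp0 : ∀ t, p t ≠ 0 := fun t => G.cp_ne (hne t).2.2 (hne t).2.1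
  have hn0 : ∀ t, n t ≠ 0 := fun t => G.cn_ne (hne t).2.2 (hne t).2.1
  have hp1 : ∀ t, dt (φ (W t)) (p t) = 0 := fun t => dt_cr_left _ _
  have hp2 : ∀ t, dt (φ t.1.2.2) (p t) = 0 := fun t => dt_cr_right _ _
  have hn1 : ∀ t, dt (n t) (p t) = 0 := fun t => by rw [dt_comm]; exact dt_cr_left _ _
  have hn2 : ∀ t, dt (n t) (gam f ξ₁ t.1.1) = 0 := fun t => by rw [dt_comm]; exact dt_cr_right _ _
  have hO : ∀ t, ((Projectivization.mk ℝ (p t) (hp0 t),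
      Projectivization.mk ℝ (fnl (n t)) (fnl_ne (hn0 t))) :
      ℙ ℝ (Fin 3 → ℝ) × ℙ ℝ (Module.Dual ℝ (Fin 3 → ℝ))) ∈ Omega2 C := by
    intro t
    refine ⟨(flag_iff _ _).mpr (hn1 t), S.tangent_out hc P (hne t).2.1 _ (hp1 t) (hp2 t), ?_⟩
    obtain ⟨v, ⟨-, hv, hvC⟩, h⟩ := S.meets hc P (hne t).1 (hne t).2.2 (hne t).2.1
    refine ⟨_, hvC, (flag_iff _ _).mpr ?_⟩
    change dt (cr (cr _ _) _) v = 0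
    rw [cr_cr, sub_dt]
    rw [sub_dt] at h
    linarith
  let Φ : TP → ↥(Omega2 C) := fun t => ⟨_, hO t⟩
  have hΦ : ∀ t b, Φ t = b ↔ t ∈ Sol (gam f ξ₁) φ W b.1.1.rep (vec b.1.2.rep) := by
    intro t b
    constructor
    · rintro rfl
      have e1 : (Φ t).1.1.rep ∈ (Φ t).1.1.submodule := by
        rw [Projectivization.submodule_eq]; exact Submodule.mem_span_singleton_self _
      have e2 : (Φ t).1.2.rep ∈ (Φ t).1.2.submodule := by
        rw [Projectivization.submodule_eq]; exact Submodule.mem_span_singleton_self _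
      change _ ∈ (Projectivization.mk ℝ (p t) (hp0 t)).submodule at e1
      change _ ∈ (Projectivization.mk ℝ (fnl (n t)) (fnl_ne (hn0 t))).submodule at e2
      rw [Projectivization.submodule_mk, Submodule.mem_span_singleton] at e1 e2
      obtain ⟨k1, e1⟩ := e1
      obtain ⟨k2, e2⟩ := e2
      refine ⟨?_, ?_, ?_⟩
      · rw [← e1, dt_smul, hp1, mul_zero]
      · rw [← e1, dt_smul, hp2, mul_zero]
      · rw [← vec_apply, ← e2]
        simp [fnl_apply, hn2]
    · rintro ⟨h1, h2, h3⟩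
      obtain ⟨k, hk⟩ := Submodule.mem_span_singleton.mp (mem_span_cr (hp0 t) h1 h2)
      have hk0 : k ≠ 0 := by
        rintro rfl
        rw [zero_smul] at hk
        exact b.1.1.rep_nonzero hk.symm
      have hfl : dt (vec b.1.2.rep) b.1.1.rep = 0 := by
        have h := b.2.1
        change b.1.1.submodule ≤ b.1.2.submodule.dualCoannihilator at h
        have e1 : b.1.1.rep ∈ b.1.1.submodule := by
          rw [Projectivization.submodule_eq]; exact Submodule.mem_span_singleton_self _
        have := (Submodule.mem_dualCoannihilator _).mp (h e1) b.1.2.rep (by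
          rw [Projectivization.submodule_eq]; exact Submodule.mem_span_singleton_self _)
        rwa [vec_apply] at this
      have hfl2 : dt (p t) (vec b.1.2.rep) = 0 := by
        rw [← hk, dt_smul] at hfl
        rw [dt_comm]
        exact (mul_eq_zero.mp hfl).resolve_left hk0
      obtain ⟨m, hm⟩ := Submodule.mem_span_singleton.mp
        (mem_span_cr (hn0 t) hfl2 (by rw [dt_comm]; exact h3))
      apply Subtype.ext
      apply Prod.ext
      · symm
        rw [← Projectivization.mk_rep b.1.1]
        exact (Projectivization.mk_eq_mk_iff' ℝ _ _ _ _).mpr ⟨k, hk⟩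
      · symm
        rw [← Projectivization.mk_rep b.1.2]
        refine (Projectivization.mk_eq_mk_iff' ℝ _ _ _ _).mpr ⟨m, ?_⟩
        rw [← fnl_vec b.1.2.rep, ← hm]
        ext1 v
        ext
        simp [fnl_apply, smul_dt]
        exact Or.inl rfl
  have hsol : ∀ b, ∃ t1 t2 u w, u ≠ w ∧ t1 ≠ t2 ∧ Φ ⁻¹' {b} = {t1, t2} ∧
      W t1 = u ∧ t1.1.2.2 = w ∧ W t2 = w ∧ t2.1.2.2 = u := by
    intro b
    obtain ⟨a, b', s, t, h1, h2, h3, h4, h5, h6⟩ := S.secant b.2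
    obtain ⟨t1, t2, u, w, g1, g2, g3, g4⟩ := G.sol hW h1 h2 h3 h4 (vec_ne b.1.2.rep_nonzero) h5 h6
    refine ⟨t1, t2, u, w, g1, g2, ?_, g4⟩
    rw [← g3]
    ext t
    exact hΦ t b
  have hcard : ∀ b, (Φ ⁻¹' {b}).ncard = 2 := by
    intro b
    obtain ⟨t1, t2, u, w, g1, g2, g3, g4⟩ := hsol b
    rw [g3, Set.ncard_pair g2]
  have hcont : Continuous Φ := by
    have cp : Continuous p := cr_cont.comp ((G.cφ.comp hWc).prodMk (G.cφ.comp (by fun_prop)))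
    have cn : Continuous n := cr_cont.comp (cp.prodMk (G.cγ.comp (by fun_prop)))
    refine Continuous.subtype_mk ?_ _
    refine Continuous.prodMk ?_ ?_
    · rw [continuous_iff_continuousAt]
      intro t
      exact mk_tendsto hp0 (hp0 t) cp.continuousAt
    · rw [continuous_iff_continuousAt]
      intro t
      exact mk_tendsto (fun t => fnl_ne (hn0 t)) (fnl_ne (hn0 t)) (fnl_cont.comp cn).continuousAt
  have hprop : IsProperMap Φ := by
    rw [isProperMap_iff_ultrafilter]
    refine ⟨hcont, ?_⟩
    intro 𝒰 b hb
    obtain ⟨a, b', s, t, h1, h2, h3, h4, h5, h6⟩ := S.secant b.2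
    have hb1 : Tendsto (fun t => (Φ t).1.1) 𝒰 (𝓝 b.1.1) :=
      ((continuous_fst.comp continuous_subtype_val).tendsto b).comp hb
    have hb2 : Tendsto (fun t => (Φ t).1.2) 𝒰 (𝓝 b.1.2) :=
      ((continuous_snd.comp continuous_subtype_val).tendsto b).comp hb
    obtain ⟨v, v1, v2⟩ := lift_tendsto hb1
    obtain ⟨m, m1, m2⟩ := lift_tendsto_dual hb2
    have v3 : ∀ t, ∃ k : ℝ, k • p t = v t := by
      intro t
      have := v1 t
      change _ ∈ (Projectivization.mk ℝ (p t) (hp0 t)).submodule at this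
      rwa [Projectivization.submodule_mk, Submodule.mem_span_singleton] at this
    have m3 : ∀ t, ∃ k : ℝ, k • fnl (n t) = fnl (m t) := by
      intro t
      have := m1 t
      change _ ∈ (Projectivization.mk ℝ (fnl (n t)) (fnl_ne (hn0 t))).submodule at this
      rwa [Projectivization.submodule_mk, Submodule.mem_span_singleton] at this
    obtain ⟨t0, k0, k1, k2, k3⟩ := G.proper hW 𝒰 h1 h2 h3 h4 (vec_ne b.1.2.rep_nonzero) h5 h6 v m v2 m2
      (fun t => by obtain ⟨k, hk⟩ := v3 t; rw [← hk, dt_smul, hp1, mul_zero])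
      (fun t => by obtain ⟨k, hk⟩ := v3 t; rw [← hk, dt_smul, hp2, mul_zero])
      (fun t => by
        obtain ⟨k, hk⟩ := m3 t
        rw [← fnl_apply, ← hk]
        simp [fnl_apply, hn2])
    exact ⟨t0, (hΦ t0 b).mpr ⟨k1, k2, k3⟩, k0⟩
  refine ⟨Φ, ?_, ?_, ?_, ?_, hcard⟩
  · intro t
    change (Projectivization.mk ℝ (p t) (hp0 t)).submodule = _
    rw [Projectivization.submodule_mk]
    exact inf_eq P (hp0 t)
  · intro t
    change (Projectivization.mk ℝ (fnl (n t)) (fnl_ne (hn0 t))).submodule = _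
    rw [Projectivization.submodule_mk, ← inf_eq P (hp0 t), S.gam_sub]
    exact span_ann (hn0 t)
  · intro b
    obtain ⟨t1, t2, u, w, g1, g2, g3, g4⟩ := hsol b
    have : t1 ∈ Φ ⁻¹' {b} := by rw [g3]; simp
    exact ⟨t1, this⟩
  · refine cover2 Φ hprop ?_ hcard
    intro b
    obtain ⟨t1, t2, u, w, g1, g2, g3, g4, g5, g6, g7⟩ := hsol b
    obtain ⟨Nu, Nw, ou, ow, hu, hw, hd⟩ := t2_separation g1
    have key : ∀ N M : Set Circle, Disjoint N M →
        Set.InjOn Φ {t : TP | W t ∈ N ∧ t.1.2.2 ∈ M} := by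
      intro N M hNM t ht t' ht' he
      obtain ⟨s1, s2, u, w, -, -, f3, f4, f5, f6, f7⟩ := hsol (Φ t)
      have m1 : t ∈ Φ ⁻¹' {Φ t} := rfl
      have m2 : t' ∈ Φ ⁻¹' {Φ t} := he.symm
      rw [f3] at m1 m2
      have hdis := Set.disjoint_left.mp hNM
      rcases m1 with rfl | rfl <;> rcases m2 with rfl | rfl
      · rfl
      · exact (hdis (f4 ▸ ht.1) (f7 ▸ ht'.2)).elim
      · exact (hdis (f4 ▸ ht'.1) (f7 ▸ ht.2)).elim
      · rfl
    have hz : Continuous (fun t : TP => t.1.2.2) := by fun_prop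
    refine ⟨{t : TP | W t ∈ Nu ∧ t.1.2.2 ∈ Nw}, {t : TP | W t ∈ Nw ∧ t.1.2.2 ∈ Nu},
      (ou.preimage hWc).inter (ow.preimage hz), (ow.preimage hWc).inter (ou.preimage hz), ?_,
      key _ _ hd, key _ _ hd.symm, ?_⟩
    · rw [Set.disjoint_left]
      rintro t ⟨h1, -⟩ ⟨h2, -⟩
      exact Set.disjoint_left.mp hd h1 h2
    · rw [g3]
      rintro t (rfl | rfl)
      · left
        exact ⟨g4 ▸ hu, g5 ▸ hw⟩
      · right
        exact ⟨g6 ▸ hw, g7 ▸ hu⟩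

end setup3

/-- For each positively oriented triple `(x,y,z)` there is a unique
`w = w(x,y,z) ≠ y` with `ξ¹(w)` on the projective line through `ξ¹(y)` and `ℙ(ξ²(x) ∩ ξ²(z))`,
and `(x,w,z)` consists of pairwise distinct points.  The map
`Φ⁻(x,y,z) = (ℙ(ξ²(w) ∩ ξ²(z)), (ξ²(w) ∩ ξ²(z)) + x¹)` is well defined with image exactly
`Ω²`, and is a two-sheeted covering map onto `Ω²`. -/
theorem statement_13
    (C : Set (ℙ ℝ (Fin 3 → ℝ))) (hCopen : IsOpen C) (hCpc : ProperlyConvex C)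
    (hstrict : StrictlyConvexBoundary C)
    (hC1 : ∀ p ∈ frontier C, ∃! W : Submodule ℝ (Fin 3 → ℝ), IsSupportingLineAt C W p)
    (ξ₁ : Circle → ℙ ℝ (Fin 3 → ℝ))
    (hξ₁ : ∃ e : Circle ≃ₜ frontier C, ∀ x, (e x : ℙ ℝ (Fin 3 → ℝ)) = ξ₁ x)
    (ξ₂ : Circle → Submodule ℝ (Fin 3 → ℝ))
    (hξ₂ : ∀ x, IsSupportingLineAt C (ξ₂ x) (ξ₁ x)) :
    ∃ w : {t : Circle × Circle × Circle // PosOriented t.1 t.2.1 t.2.2} → Circle,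
      (∀ t, w t ≠ t.1.2.1 ∧
        (ξ₁ (w t)).submodule ≤ (ξ₁ t.1.2.1).submodule ⊔ (ξ₂ t.1.1 ⊓ ξ₂ t.1.2.2) ∧
        (∀ w' : Circle, w' ≠ t.1.2.1 →
          (ξ₁ w').submodule ≤ (ξ₁ t.1.2.1).submodule ⊔ (ξ₂ t.1.1 ⊓ ξ₂ t.1.2.2) →
          w' = w t) ∧
        w t ≠ t.1.1 ∧ w t ≠ t.1.2.2) ∧
      ∃ Φ : {t : Circle × Circle × Circle // PosOriented t.1 t.2.1 t.2.2} → ↥(Omega2 C),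
        (∀ t, (Φ t : ℙ ℝ (Fin 3 → ℝ) × ℙ ℝ (Module.Dual ℝ (Fin 3 → ℝ))).1.submodule =
            ξ₂ (w t) ⊓ ξ₂ t.1.2.2) ∧
        (∀ t, (Φ t : ℙ ℝ (Fin 3 → ℝ) × ℙ ℝ (Module.Dual ℝ (Fin 3 → ℝ))).2.submodule =
            ((ξ₂ (w t) ⊓ ξ₂ t.1.2.2) ⊔ (ξ₁ t.1.1).submodule).dualAnnihilator) ∧
        Function.Surjective Φ ∧
        IsCoveringMap Φ ∧
        (∀ b, (Φ ⁻¹' {b}).ncard = 2) := by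
  obtain ⟨f, hf, hconv⟩ := hCpc
  exact (Setup.mk (f := f) hCopen hf hconv hstrict hC1 hξ₁ hξ₂).main

end CFF
end
end

section
/- Let C ⊆ ℙ(ℝ³) be a properly convex open set and let L be a supporting line of C at some point of the frontier of C. If M is any projective line contained in closure(C) ∪ L, then M = L. In other words, L is the unique projective line contained in the complement of the concave domain ℙ(ℝ³) ∖ (closure(C) ∪ L). -/
noncomputable section

open Filter Topology Module
open scoped LinearAlgebra.Projectivization

namespace CFF

/-- If `C` is a properly convex open set and `L = ℙ(W)` is a supporting line
of `C` at some frontier point, then any projective line contained in `closure C ∪ L` equals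
`L`; i.e. `L` is the unique projective line in the complement of the concave domain
`ℙ(ℝ³) ∖ (closure C ∪ L)`. -/
theorem statement_14
    (C : Set (ℙ ℝ (Fin 3 → ℝ))) (hCopen : IsOpen C) (hCpc : ProperlyConvex C)
    (W : Submodule ℝ (Fin 3 → ℝ)) (p : ℙ ℝ (Fin 3 → ℝ))
    (hW : IsSupportingLineAt C W p)
    (W' : Submodule ℝ (Fin 3 → ℝ)) (hW' : finrank ℝ ↥W' = 2)
    (hsub : projLine W' ⊆ closure C ∪ projLine W) :
    W' = W := by
  by_contra hne
  obtain ⟨f, hf, -⟩ := hCpc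
  obtain ⟨hW2, -, -, -⟩ := hW
  have hnle : ¬ W' ≤ W := fun h =>
    hne (Submodule.eq_of_le_of_finrank_eq h (by rw [hW2, hW']))
  obtain ⟨u, huW', huW⟩ := SetLike.not_le_iff_exists.1 hnle
  have hker : LinearMap.ker (f.comp W'.subtype) ≠ ⊥ := by
    apply LinearMap.ker_ne_bot_of_finrank_lt
    rw [hW']
    simp
  obtain ⟨v', hv'k, hv'0⟩ := Submodule.exists_mem_ne_zero_of_ne_bot hker
  obtain ⟨v, hvW'⟩ := v'
  have hv0 : v ≠ 0 := fun h => hv'0 (by ext1; exact h)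
  have hfv : f v = 0 := by simpa using hv'k
  have key : ∀ (x : Fin 3 → ℝ) (hx : x ≠ 0), x ∈ W' →
      Projectivization.mk ℝ x hx ∈ closure C ∨ x ∈ W := by
    intro x hx hxW'
    have h1 : Projectivization.mk ℝ x hx ∈ projLine W' := by
      simp only [projLine, Set.mem_setOf_eq, Projectivization.submodule_mk]
      exact (Submodule.span_singleton_le_iff_mem x W').2 hxW'
    rcases hsub h1 with h | h
    · exact Or.inl h
    · right
      simp only [projLine, Set.mem_setOf_eq, Projectivization.submodule_mk] at h
      exact (Submodule.span_singleton_le_iff_mem x W).1 h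
  have hvW : v ∈ W := (key v hv0 hvW').resolve_left (fun h => hf v hv0 h hfv)
  have hnW : ∀ s : ℝ, s ≠ 0 → v + s • u ∉ W := fun s hs h =>
    huW ((W.smul_mem_iff hs).1 ((W.add_mem_iff_right hvW).1 h))
  have hnz : ∀ s : ℝ, v + s • u ≠ 0 := by
    intro s h
    by_cases hs : s = 0
    · subst hs
      exact hv0 (by simpa using h)
    · exact hnW s hs (h ▸ W.zero_mem)
  have hcont : Continuous fun s : ℝ => Projectivization.mk ℝ (v + s • u) (hnz s) := by
    have h1 : Continuous fun s : ℝ =>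
        (⟨v + s • u, hnz s⟩ : {w : Fin 3 → ℝ // w ≠ 0}) := by fun_prop
    exact (continuous_quot_mk (r := (projectivizationSetoid ℝ (Fin 3 → ℝ)).r)).comp h1
  have hcl : IsClosed {s : ℝ | Projectivization.mk ℝ (v + s • u) (hnz s) ∈ closure C} :=
    isClosed_closure.preimage hcont
  have hall : (0 : ℝ) ∈ {s : ℝ | Projectivization.mk ℝ (v + s • u) (hnz s) ∈ closure C} := by
    have hd : Dense ({0}ᶜ : Set ℝ) := dense_compl_singleton 0
    refine closure_minimal ?_ hcl (hd 0)
    intro s hs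
    exact (key _ (hnz s) (W'.add_mem hvW' (W'.smul_mem s huW'))).resolve_right (hnW s hs)
  exact hf _ (hnz 0) hall (by simp [hfv])


end CFF
end
end

section
/- Let g ∈ GL(2, ℝ) and let v_a, v_b be linearly independent eigenvectors of g with eigenvalues λ_a and λ_b. The set ℙ(ℝ²) ∖ {[v_a], [v_b]} has exactly two connected components; if I is one of them and the induced projective action of g satisfies g·I = I, then λ_a λ_b > 0. -/
noncomputable section

open Filter Topology Module
open scoped LinearAlgebra.Projectivization

namespace CFF

abbrev E2 := Fin 2 → ℝ

def qf (b : Basis (Fin 2) ℝ E2) (v : E2) : ℝ := b.repr v 0 * b.repr v 1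

lemma qf_smul (b : Basis (Fin 2) ℝ E2) (c : ℝ) (v : E2) : qf b (c • v) = c ^ 2 * qf b v := by
  simp [qf]; ring

lemma qf_cont (b : Basis (Fin 2) ℝ E2) : Continuous (qf b) := by
  have h : ∀ i, Continuous (fun v : E2 => b.repr v i) := fun i =>
    (b.coord i).continuous_of_finiteDimensional
  exact (h 0).mul (h 1)

def SS (b : Basis (Fin 2) ℝ E2) (e : ℝ) : Set (ℙ ℝ E2) := {p | 0 < e * qf b p.rep}

lemma mk_mem_SS (b : Basis (Fin 2) ℝ E2) (e : ℝ) (v : E2) (hv : v ≠ 0) :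
    Projectivization.mk ℝ v hv ∈ SS b e ↔ 0 < e * qf b v := by
  obtain ⟨a, h⟩ := Projectivization.exists_smul_eq_mk_rep ℝ v hv
  have ha : 0 < (a : ℝ) ^ 2 := by have := a.ne_zero; positivity
  have h2 : qf b (Projectivization.mk ℝ v hv).rep = (a : ℝ) ^ 2 * qf b v := by
    rw [← h, ← qf_smul]; rfl
  simp only [SS, Set.mem_setOf_eq, h2]
  rw [show e * ((a : ℝ) ^ 2 * qf b v) = (a : ℝ) ^ 2 * (e * qf b v) by ring]
  exact mul_pos_iff_of_pos_left ha

lemma cont_mk : Continuous (fun v : {v : E2 // v ≠ 0} => Projectivization.mk ℝ v.1 v.2) :=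
  continuous_quotient_mk'

lemma open_SS (b : Basis (Fin 2) ℝ E2) (e : ℝ) : IsOpen (SS b e) := by
  have hq : IsQuotientMap (fun v : {v : E2 // v ≠ 0} => Projectivization.mk ℝ v.1 v.2) :=
    isQuotientMap_quotient_mk'
  rw [← hq.isOpen_preimage]
  have : ((fun v : {v : E2 // v ≠ 0} => Projectivization.mk ℝ v.1 v.2) ⁻¹' SS b e)
      = {v | 0 < e * qf b v.1} := by
    ext v; exact mk_mem_SS b e v.1 v.2
  rw [this]
  exact isOpen_lt continuous_const
    (continuous_const.mul ((qf_cont b).comp continuous_subtype_val))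

lemma repr_add (b : Basis (Fin 2) ℝ E2) (s t : ℝ) :
    b.repr (s • b 0 + t • b 1) 0 = s ∧ b.repr (s • b 0 + t • b 1) 1 = t := by
  simp

lemma ray_ne (b : Basis (Fin 2) ℝ E2) (t : ℝ) : b 0 + t • b 1 ≠ 0 := by
  intro h
  have := (repr_add b 1 t).1
  rw [one_smul, h] at this
  simp at this

lemma conn_SS (b : Basis (Fin 2) ℝ E2) (e : ℝ) : IsPreconnected (SS b e) := by
  have hc : Convex ℝ {t : ℝ | 0 < e * t} := by
    intro s hs t ht p q hp hq hpq
    simp only [Set.mem_setOf_eq, smul_eq_mul] at *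
    rcases hp.eq_or_lt with rfl | hp
    · have : q = 1 := by linarith
      subst this; simpa using ht
    · have h1 := mul_pos hp hs
      have h2 := mul_nonneg hq ht.le
      nlinarith
  have hf : Continuous (fun t : ℝ => Projectivization.mk ℝ (b 0 + t • b 1) (ray_ne b t)) := by
    have h1 : Continuous (fun t : ℝ => (⟨b 0 + t • b 1, ray_ne b t⟩ : {v : E2 // v ≠ 0})) := by
      apply Continuous.subtype_mk
      fun_prop
    exact cont_mk.comp h1
  have : SS b e = (fun t : ℝ => Projectivization.mk ℝ (b 0 + t • b 1) (ray_ne b t)) ''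
      {t : ℝ | 0 < e * t} := by
    ext p
    constructor
    · induction p using Projectivization.ind with
      | h v hv =>
      intro h
      rw [mk_mem_SS] at h
      have hx : b.repr v 0 ≠ 0 := by
        intro h0; simp [qf, h0] at h
      refine ⟨b.repr v 1 / b.repr v 0, ?_, ?_⟩
      · have : e * (b.repr v 1 / b.repr v 0) = (e * qf b v) / (b.repr v 0) ^ 2 := by
          simp only [qf]; field_simp
        simp only [Set.mem_setOf_eq, this]
        positivity
      · simp only
        rw [Projectivization.mk_eq_mk_iff']
        refine ⟨(b.repr v 0)⁻¹, ?_⟩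
        conv_lhs => arg 2; rw [← b.sum_repr v]
        rw [Fin.sum_univ_two, smul_add, smul_smul, smul_smul, inv_mul_cancel₀ hx, one_smul]
        congr 2
        field_simp
    · rintro ⟨t, ht, rfl⟩
      simp only
      rw [mk_mem_SS]
      have := repr_add b 1 t
      rw [one_smul] at this
      simpa [qf, this.1, this.2] using ht
  rw [this]
  exact hc.isPreconnected.image _ hf.continuousOn

lemma compl_eq (b : Basis (Fin 2) ℝ E2) (pa pb : ℙ ℝ E2)
    (hpa : pa.submodule = Submodule.span ℝ {b 0}) (hpb : pb.submodule = Submodule.span ℝ {b 1}) :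
    ({pa, pb}ᶜ : Set (ℙ ℝ E2)) = SS b 1 ∪ SS b (-1) := by
  have ea : pa = Projectivization.mk ℝ (b 0) (b.ne_zero 0) := by
    apply Projectivization.submodule_injective
    rw [hpa, Projectivization.submodule_mk]
  have eb : pb = Projectivization.mk ℝ (b 1) (b.ne_zero 1) := by
    apply Projectivization.submodule_injective
    rw [hpb, Projectivization.submodule_mk]
  subst ea eb
  ext p
  induction p using Projectivization.ind with
  | h v hv =>
  rw [Set.mem_union, mk_mem_SS, mk_mem_SS]
  have h1 : (0 < 1 * qf b v ∨ 0 < -1 * qf b v) ↔ qf b v ≠ 0 := by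
    rw [ne_iff_lt_or_gt, or_comm]; simp
  rw [h1]
  simp only [Set.mem_compl_iff, Set.mem_insert_iff, Set.mem_singleton_iff,
    Projectivization.mk_eq_mk_iff']
  apply not_congr
  have hs := b.sum_repr v
  rw [Fin.sum_univ_two] at hs
  simp only [qf, mul_eq_zero]
  constructor
  · rintro (⟨a, rfl⟩ | ⟨a, rfl⟩) <;> simp
  · rintro (h | h)
    · right; exact ⟨b.repr v 1, by simpa [h] using hs⟩
    · left; exact ⟨b.repr v 0, by simpa [h] using hs⟩

lemma comp_eq (b : Basis (Fin 2) ℝ E2) (e : ℝ) (s : Set (ℙ ℝ E2)) (hs : s = SS b e ∪ SS b (-e))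
    (p : ℙ ℝ E2) (hp : p ∈ SS b e) : connectedComponentIn s p = SS b e := by
  have hps : p ∈ s := hs ▸ Or.inl hp
  apply Set.Subset.antisymm
  · apply isPreconnected_connectedComponentIn.subset_left_of_subset_union (open_SS b e)
      (open_SS b (-e))
    · rw [Set.disjoint_left]
      intro q h1 h2
      simp only [SS, Set.mem_setOf_eq] at h1 h2
      linarith
    · rw [← hs]; exact connectedComponentIn_subset _ _
    · exact ⟨p, mem_connectedComponentIn hps, hp⟩
  · exact (conn_SS b e).subset_connectedComponentIn hp (hs ▸ Set.subset_union_left)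

/-- Let `g ∈ GL(2,ℝ)` and let `v_a, v_b` be linearly independent eigenvectors
of `g` with eigenvalues `λ_a, λ_b`.  The set `ℙ(ℝ²) ∖ {[v_a], [v_b]}` has exactly two connected
components; and if `I` is one of them with `g·I = I`, then `λ_a λ_b > 0`. -/
theorem statement_16
    (g : (Fin 2 → ℝ) ≃ₗ[ℝ] (Fin 2 → ℝ))
    (va vb : Fin 2 → ℝ) (hind : LinearIndependent ℝ ![va, vb])
    (la lb : ℝ) (ha : g va = la • va) (hb : g vb = lb • vb) :
    ∀ pa pb : ℙ ℝ (Fin 2 → ℝ),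
      pa.submodule = Submodule.span ℝ {va} → pb.submodule = Submodule.span ℝ {vb} →
      (∃ U V : Set (ℙ ℝ (Fin 2 → ℝ)), U ≠ V ∧
        (∃ p ∈ ({pa, pb}ᶜ : Set (ℙ ℝ (Fin 2 → ℝ))),
          connectedComponentIn {pa, pb}ᶜ p = U) ∧
        (∃ p ∈ ({pa, pb}ᶜ : Set (ℙ ℝ (Fin 2 → ℝ))),
          connectedComponentIn {pa, pb}ᶜ p = V) ∧
        (∀ p ∈ ({pa, pb}ᶜ : Set (ℙ ℝ (Fin 2 → ℝ))),
          connectedComponentIn {pa, pb}ᶜ p = U ∨ connectedComponentIn {pa, pb}ᶜ p = V)) ∧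
      (∀ p ∈ ({pa, pb}ᶜ : Set (ℙ ℝ (Fin 2 → ℝ))),
        Projectivization.map (g : (Fin 2 → ℝ) →ₗ[ℝ] (Fin 2 → ℝ)) g.injective ''
            connectedComponentIn {pa, pb}ᶜ p = connectedComponentIn {pa, pb}ᶜ p →
        la * lb > 0) := by
  intro pa pb hpa hpb
  let b : Basis (Fin 2) ℝ E2 := basisOfLinearIndependentOfCardEqFinrank hind (by simp)
  have b0 : b 0 = va := by simp [b]
  have b1 : b 1 = vb := by simp [b]
  clear_value b
  subst b0 b1
  have hc := compl_eq b pa pb hpa hpb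
  have hc' : ({pa, pb}ᶜ : Set (ℙ ℝ E2)) = SS b (-1) ∪ SS b (-(-1)) := by
    rw [hc, neg_neg, Set.union_comm]
  have hm : ∀ t : ℝ, ∀ e : ℝ, Projectivization.mk ℝ (b 0 + t • b 1) (ray_ne b t) ∈ SS b e ↔
      0 < e * t := by
    intro t e
    rw [mk_mem_SS]
    have := repr_add b 1 t
    rw [one_smul] at this
    simp [qf, this.1, this.2]
  have hp1 := (hm 1 1).2 (by norm_num)
  have hp2 := (hm (-1) (-1)).2 (by norm_num)
  refine ⟨⟨SS b 1, SS b (-1), ?_, ⟨_, hc ▸ Or.inl hp1, comp_eq b 1 _ hc _ hp1⟩,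
    ⟨_, hc ▸ Or.inr hp2, comp_eq b (-1) _ hc' _ hp2⟩, ?_⟩, ?_⟩
  · intro h
    rw [h, hm] at hp1
    norm_num at hp1
  · intro p hp
    rw [hc] at hp
    rcases hp with hp | hp
    · exact Or.inl (comp_eq b 1 _ hc _ hp)
    · exact Or.inr (comp_eq b (-1) _ hc' _ hp)
  · intro p hp hI
    have key : ∀ e : ℝ, p ∈ SS b e →
        Projectivization.map (g : E2 →ₗ[ℝ] E2) g.injective '' SS b e = SS b e →
        la * lb > 0 := by
      intro e hpe hI
      have h2 := hI ▸ Set.mem_image_of_mem _ hpe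
      clear hI hp
      induction p using Projectivization.ind with
      | h v hv =>
      rw [Projectivization.map_mk, mk_mem_SS] at h2
      rw [mk_mem_SS] at hpe
      have hg : g v = (b.repr v 0 * la) • b 0 + (b.repr v 1 * lb) • b 1 := by
        conv_lhs => rw [← b.sum_repr v]
        rw [Fin.sum_univ_two, map_add, map_smul, map_smul, ha, hb, smul_smul, smul_smul]
      have hr := repr_add b (b.repr v 0 * la) (b.repr v 1 * lb)
      rw [← hg] at hr
      have hq : e * qf b (g v) = (e * qf b v) * (la * lb) := by
        simp only [qf, hr.1, hr.2]; ring
      have h3 : 0 < e * qf b (g v) := h2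
      rw [hq] at h3
      exact (mul_pos_iff_of_pos_left hpe).1 h3
    have hp' := hp
    rw [hc] at hp'
    rcases hp' with h | h
    · exact key 1 h (by rwa [comp_eq b 1 _ hc _ h] at hI)
    · exact key (-1) h (by rwa [comp_eq b (-1) _ hc' _ h] at hI)

end CFF
end
end

section
/- Let g ∈ GL(3, ℝ) and suppose there are nonzero vectors v₁, v₂, v₃ ∈ ℝ³ and real numbers λ₁, λ₂, λ₃ with g vᵢ = λᵢ vᵢ for i = 1, 2, 3 and |λ₁| > |λ₂| > |λ₃| > 0. Let V ⊆ ℙ(ℝ³) be an open neighborhood of [v₃]. Then ℙ(ℝ³) ∖ ℙ(span{v₁, v₂}) ⊆ ⋃_{n ≥ 0} gⁿ·V, where ℙ(span{v₁, v₂}) denotes the projective line of 1-dimensional subspaces contained in span{v₁, v₂} and gⁿ·V is the image of V under the n-fold iterate of the projective action of g. -/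
noncomputable section

open Filter Topology Module
open scoped LinearAlgebra.Projectivization

namespace CFF

/-- Let `g ∈ GL(3,ℝ)` have eigenvectors `v₁, v₂, v₃` with eigenvalues of
moduli `|λ₁| > |λ₂| > |λ₃| > 0`, and let `V` be an open neighbourhood of `[v₃]` in `ℙ(ℝ³)`.
Then every point of `ℙ(ℝ³)` outside the projective line `ℙ(span{v₁, v₂})` lies in `gⁿ·V` for
some `n ≥ 0`. -/
theorem statement_17
    (g : (Fin 3 → ℝ) ≃ₗ[ℝ] (Fin 3 → ℝ))
    (v₁ v₂ v₃ : Fin 3 → ℝ) (hv₁ : v₁ ≠ 0) (hv₂ : v₂ ≠ 0) (hv₃ : v₃ ≠ 0)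
    (l₁ l₂ l₃ : ℝ)
    (heig₁ : g v₁ = l₁ • v₁) (heig₂ : g v₂ = l₂ • v₂) (heig₃ : g v₃ = l₃ • v₃)
    (hl₁₂ : |l₂| < |l₁|) (hl₂₃ : |l₃| < |l₂|) (hl₃ : 0 < |l₃|)
    (V : Set (ℙ ℝ (Fin 3 → ℝ))) (hVopen : IsOpen V)
    (hv₃V : Projectivization.mk ℝ v₃ hv₃ ∈ V) :
    {p : ℙ ℝ (Fin 3 → ℝ) | ¬ p.submodule ≤ Submodule.span ℝ {v₁, v₂}} ⊆
      ⋃ n : ℕ,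
        (Projectivization.map (g : (Fin 3 → ℝ) →ₗ[ℝ] (Fin 3 → ℝ)) g.injective)^[n] '' V := by
  have h3 : l₃ ≠ 0 := abs_pos.mp hl₃
  have h2 : l₂ ≠ 0 := abs_pos.mp (hl₃.trans hl₂₃)
  have h1 : l₁ ≠ 0 := abs_pos.mp ((hl₃.trans hl₂₃).trans hl₁₂)
  have hli : LinearIndependent ℝ ![v₁, v₂, v₃] := by
    apply Module.End.eigenvectors_linearIndependent'
      (g : (Fin 3 → ℝ) →ₗ[ℝ] (Fin 3 → ℝ)) ![l₁, l₂, l₃]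
    · have n12 : l₁ ≠ l₂ := fun h => by rw [h] at hl₁₂; exact lt_irrefl _ hl₁₂
      have n23 : l₂ ≠ l₃ := fun h => by rw [h] at hl₂₃; exact lt_irrefl _ hl₂₃
      have n13 : l₁ ≠ l₃ := fun h => by rw [h] at hl₁₂; exact lt_asymm hl₁₂ hl₂₃
      intro i j hij
      fin_cases i <;> fin_cases j <;> simp_all
    · intro i
      fin_cases i
      · exact Module.End.hasEigenvector_iff.mpr ⟨Module.End.mem_eigenspace_iff.mpr heig₁, hv₁⟩
      · exact Module.End.hasEigenvector_iff.mpr ⟨Module.End.mem_eigenspace_iff.mpr heig₂, hv₂⟩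
      · exact Module.End.hasEigenvector_iff.mpr ⟨Module.End.mem_eigenspace_iff.mpr heig₃, hv₃⟩
  have hspan : Submodule.span ℝ (Set.range ![v₁, v₂, v₃]) = ⊤ :=
    hli.span_eq_top_of_card_eq_finrank (by simp)
  intro p hp
  induction p using Projectivization.ind with
  | h w hw =>
  simp only [Set.mem_ofPred_eq, Projectivization.submodule_mk,
    Submodule.span_singleton_le_iff_mem] at hp
  have hwm : w ∈ Submodule.span ℝ (Set.range ![v₁, v₂, v₃]) := hspan ▸ Submodule.mem_top
  obtain ⟨k, hk⟩ := (Submodule.mem_span_range_iff_exists_fun ℝ).mp hwm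
  simp only [Fin.sum_univ_three, Matrix.cons_val_zero, Matrix.cons_val_one,
    Matrix.cons_val] at hk
  have hc : k 2 ≠ 0 := by
    intro hc
    apply hp
    rw [Submodule.mem_span_pair]
    exact ⟨k 0, k 1, by rw [← hk, hc]; simp⟩
  let u : ℕ → (Fin 3 → ℝ) := fun n =>
    (k 0 * (l₃ / l₁) ^ n) • v₁ + (k 1 * (l₃ / l₂) ^ n) • v₂ + k 2 • v₃
  have it : ∀ (n : ℕ) (l : ℝ) (v : Fin 3 → ℝ), g v = l • v →
      ((g : (Fin 3 → ℝ) →ₗ[ℝ] (Fin 3 → ℝ)) ^ n) v = l ^ n • v := by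
    intro n l v h
    induction n with
    | zero => simp
    | succ n ih =>
      rw [pow_succ', Module.End.mul_apply, ih, map_smul]
      simp only [LinearEquiv.coe_coe, h, smul_smul, pow_succ]
  have hgu : ∀ n, ((g : (Fin 3 → ℝ) →ₗ[ℝ] (Fin 3 → ℝ)) ^ n) (u n) = l₃ ^ n • w := by
    intro n
    simp only [u, map_add, map_smul, it n _ _ heig₁, it n _ _ heig₂, it n _ _ heig₃]
    rw [← hk]
    simp only [smul_add, smul_smul]
    have e1 : k 0 * (l₃ / l₁) ^ n * l₁ ^ n = l₃ ^ n * k 0 := by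
      rw [div_pow]; field_simp
    have e2 : k 1 * (l₃ / l₂) ^ n * l₂ ^ n = l₃ ^ n * k 1 := by
      rw [div_pow]; field_simp
    rw [e1, e2, mul_comm (k 2)]
  have hu0 : ∀ n, u n ≠ 0 := by
    intro n h
    have := hgu n
    rw [h, map_zero] at this
    exact smul_ne_zero (pow_ne_zero n h3) hw this.symm
  have t1 : Tendsto (fun n : ℕ => (l₃ / l₁) ^ n) atTop (𝓝 0) := by
    apply tendsto_pow_atTop_nhds_zero_of_abs_lt_one
    rw [abs_div, div_lt_one (abs_pos.mpr h1)]
    exact hl₂₃.trans hl₁₂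
  have t2 : Tendsto (fun n : ℕ => (l₃ / l₂) ^ n) atTop (𝓝 0) := by
    apply tendsto_pow_atTop_nhds_zero_of_abs_lt_one
    rw [abs_div, div_lt_one (abs_pos.mpr h2)]
    exact hl₂₃
  have tu : Tendsto u atTop (𝓝 (k 2 • v₃)) := by
    have := (((t1.const_mul (k 0)).smul_const v₁).add
      ((t2.const_mul (k 1)).smul_const v₂)).add_const (k 2 • v₃)
    simpa using this
  have hc0 : k 2 • v₃ ≠ 0 := smul_ne_zero hc hv₃
  have tu' : Tendsto (fun n => (⟨u n, hu0 n⟩ : {v : Fin 3 → ℝ // v ≠ 0})) atTop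
      (𝓝 ⟨k 2 • v₃, hc0⟩) := tendsto_subtype_rng.mpr tu
  have hcont : Continuous (fun v : {v : Fin 3 → ℝ // v ≠ 0} => Projectivization.mk ℝ v.1 v.2) :=
    continuous_quotient_mk'
  have hmem : Projectivization.mk ℝ (k 2 • v₃) hc0 ∈ V := by
    have : Projectivization.mk ℝ (k 2 • v₃) hc0 = Projectivization.mk ℝ v₃ hv₃ :=
      (Projectivization.mk_eq_mk_iff' ℝ _ _ _ _).mpr ⟨k 2, rfl⟩
    rwa [this]
  have hev := tu'.eventually ((hVopen.preimage hcont).mem_nhds hmem)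
  obtain ⟨n, hn⟩ := hev.exists
  have hiter : ∀ (n : ℕ) (x : Fin 3 → ℝ) (hx : x ≠ 0)
      (hy : ((g : (Fin 3 → ℝ) →ₗ[ℝ] (Fin 3 → ℝ)) ^ n) x ≠ 0),
      (Projectivization.map (g : (Fin 3 → ℝ) →ₗ[ℝ] (Fin 3 → ℝ)) g.injective)^[n]
        (Projectivization.mk ℝ x hx) = Projectivization.mk ℝ _ hy := by
    intro n
    induction n with
    | zero => intro x hx hy; rfl
    | succ n ih =>
      intro x hx hy
      rw [Function.iterate_succ_apply, Projectivization.map_mk]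
      exact ih _ _ hy
  refine Set.mem_iUnion.mpr ⟨n, Projectivization.mk ℝ (u n) (hu0 n), hn, ?_⟩
  rw [hiter n (u n) (hu0 n) (by rw [hgu]; exact smul_ne_zero (pow_ne_zero n h3) hw)]
  exact (Projectivization.mk_eq_mk_iff' ℝ _ _ _ _).mpr ⟨l₃ ^ n, (hgu n).symm⟩

end CFF
end
end

section
/- Let V be a finite-dimensional vector space over a field, and let X¹ ⊆ X² and Z¹ ⊆ Z² be subspaces of V with dim X¹ = dim Z¹ = 1 and dim X² = dim Z² = 2, and let Y ⊆ V be a subspace of codimension 1. Assume X² ∩ Z² = {0} and X¹ ∩ Y = {0}. Then ((X² + Z¹) ∩ Y) + ((X¹ + Z²) ∩ Y) = (X² + Z²) ∩ Y. -/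
open Module

/-- Let `V` be a finite-dimensional vector space, `X¹ ⊆ X²`, `Z¹ ⊆ Z²`
subspaces with `dim X¹ = dim Z¹ = 1`, `dim X² = dim Z² = 2`, and `Y` a subspace of codimension
one.  If `X² ∩ Z² = 0` and `X¹ ∩ Y = 0`, then
`((X² + Z¹) ∩ Y) + ((X¹ + Z²) ∩ Y) = (X² + Z²) ∩ Y`. -/
theorem statement_19
    {K V : Type*} [Field K] [AddCommGroup V] [Module K V] [FiniteDimensional K V]
    (X₁ X₂ Z₁ Z₂ Y : Submodule K V)
    (hX : X₁ ≤ X₂) (hZ : Z₁ ≤ Z₂)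
    (hX₁ : finrank K ↥X₁ = 1) (hZ₁ : finrank K ↥Z₁ = 1)
    (hX₂ : finrank K ↥X₂ = 2) (hZ₂ : finrank K ↥Z₂ = 2)
    (hY : finrank K V = finrank K ↥Y + 1)
    (hXZ : X₂ ⊓ Z₂ = ⊥) (hXY : X₁ ⊓ Y = ⊥) :
    ((X₂ ⊔ Z₁) ⊓ Y) ⊔ ((X₁ ⊔ Z₂) ⊓ Y) = (X₂ ⊔ Z₂) ⊓ Y := by
  have htop : X₁ ⊔ Y = ⊤ := by
    apply Submodule.eq_top_of_finrank_eq
    have h := Submodule.finrank_sup_add_finrank_inf_eq X₁ Y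
    rw [hXY, finrank_bot] at h
    omega
  apply le_antisymm
  · exact sup_le (inf_le_inf_right _ (sup_le_sup_left hZ _))
      (inf_le_inf_right _ (sup_le_sup_right hX _))
  · rintro v ⟨hv, hvY⟩
    obtain ⟨x, hx, z, hz, rfl⟩ := Submodule.mem_sup.1 hv
    have hzt : z ∈ X₁ ⊔ Y := htop ▸ Submodule.mem_top
    obtain ⟨a, ha, y, hy, rfl⟩ := Submodule.mem_sup.1 hzt
    refine Submodule.mem_sup.2 ⟨x + a, ⟨?_, ?_⟩, y, ⟨?_, hy⟩, by abel⟩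
    · exact Submodule.mem_sup_left (X₂.add_mem hx (hX ha))
    · have h := Y.sub_mem hvY hy
      have e : x + (a + y) - y = x + a := by abel
      rwa [e] at h
    · have h := (X₁ ⊔ Z₂).sub_mem (Submodule.mem_sup_right hz) (Submodule.mem_sup_left ha)
      have e : a + y - a = y := by abel
      rwa [e] at h
end
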